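/- arXiv:2504.12519 — 3 statements merged into one kernel-verified Lean document; each statement's English description precedes it below -/
import Mathlib

section
/- Assume there exist constants ξ_V > 0 and C_V > 0 such that V_t = C_V·t^{−ξ_V}·(1+o(1)) as t → ∞, that U_Σ < 1, and that U_t = O(t^{−ξ_U}) as t → ∞ for some ξ_U > max(ξ_V, 1). Then L_t = (C_V/(2(1−U_Σ)))·t^{−ξ_V}·(1+o(1)) as t → ∞. -/
open Filter Topology Asymptotics
open scoped Classical

/-- The propagator expansion of the loss:
`L_t = (1/2)·(V_{t+1} + Σ_{m=1}^{t} Σ_{0<t_1<⋯<t_m<t+1}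
  U_{t+1−t_m}·U_{t_m−t_{m−1}}⋯U_{t_2−t_1}·V_{t_1})`. -/
noncomputable def lossSeq (U V : ℕ → ℝ) (t : ℕ) : ℝ :=
  (1 / 2) * (V (t + 1) +
    ∑ m ∈ Finset.range t,
      ∑ τ ∈ Finset.univ.filter
          (fun τ : Fin (m + 1) → Fin (t + 1) => StrictMono τ ∧ 0 < (τ 0 : ℕ)),
        U ((t + 1) - (τ (Fin.last m) : ℕ)) *
          (∏ j : Fin m, U ((τ j.succ : ℕ) - (τ j.castSucc : ℕ))) * V (τ 0))

/-- Sum over strictly increasing tuples, valued in the naturals. -/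
noncomputable def pathSum (U V : ℕ → ℝ) (m n : ℕ) : ℝ :=
  ∑ τ ∈ (Fintype.piFinset (fun _ : Fin (m + 1) => Finset.range n)).filter
      (fun τ => StrictMono τ ∧ 0 < τ 0),
    U (n - τ (Fin.last m)) * (∏ j : Fin m, U (τ j.succ - τ j.castSucc)) * V (τ 0)

lemma fin_sum_eq_pathSum (U V : ℕ → ℝ) (m n : ℕ) :
    ∑ τ ∈ Finset.univ.filter
          (fun τ : Fin (m + 1) → Fin n => StrictMono τ ∧ 0 < (τ 0 : ℕ)),
        U (n - (τ (Fin.last m) : ℕ)) *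
          (∏ j : Fin m, U ((τ j.succ : ℕ) - (τ j.castSucc : ℕ))) * V (τ 0) = pathSum U V m n := by
  unfold pathSum
  refine Finset.sum_bij (fun τ _ => fun i => (τ i : ℕ)) ?_ ?_ ?_ ?_
  · intro τ hτ
    simp only [Finset.mem_filter, Finset.mem_univ, true_and, Fintype.mem_piFinset,
      Finset.mem_range] at hτ ⊢
    exact ⟨fun i => (τ i).2, fun i j hij => hτ.1 hij, hτ.2⟩
  · intro τ _ τ' _ h
    funext i
    exact Fin.ext (congrFun h i)
  · intro σ hσ
    simp only [Finset.mem_filter, Fintype.mem_piFinset, Finset.mem_range] at hσ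
    refine ⟨fun i => ⟨σ i, hσ.1 i⟩, ?_, rfl⟩
    simp only [Finset.mem_filter, Finset.mem_univ, true_and]
    exact ⟨fun i j hij => hσ.2.1 hij, hσ.2.2⟩
  · intro τ _
    rfl

lemma pathSum_zero (U V : ℕ → ℝ) (n : ℕ) :
    pathSum U V 0 n = ∑ s ∈ Finset.range n, U (n - s) * (if s = 0 then 0 else V s) := by
  unfold pathSum
  have : ∑ s ∈ Finset.range n, U (n - s) * (if s = 0 then 0 else V s)
      = ∑ s ∈ (Finset.range n).filter (fun s => 0 < s), U (n - s) * V s := by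
    rw [Finset.sum_filter]
    refine Finset.sum_congr rfl fun s _ => ?_
    rcases Nat.eq_zero_or_pos s with h | h
    · simp [h]
    · simp [h, h.ne']
  rw [this]
  refine Finset.sum_bij' (fun τ _ => τ 0) (fun s _ => fun _ => s) ?_ ?_ ?_ ?_ ?_
  · intro τ hτ
    simp only [Finset.mem_filter, Fintype.mem_piFinset, Finset.mem_range] at hτ ⊢
    exact ⟨hτ.1 0, hτ.2.2⟩
  · intro s hs
    simp only [Finset.mem_filter, Fintype.mem_piFinset, Finset.mem_range] at hs ⊢
    exact ⟨fun _ => hs.1, fun i j hij => by omega, hs.2⟩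
  · intro τ _
    funext i
    rw [show i = 0 by omega]
  · intro s _
    rfl
  · intro τ _
    simp

lemma pathSum_succ (U V : ℕ → ℝ) (m n : ℕ) :
    pathSum U V (m + 1) n = ∑ s ∈ Finset.range n, U (n - s) * pathSum U V m s := by
  unfold pathSum
  simp_rw [Finset.mul_sum]
  rw [Finset.sum_sigma']
  refine Finset.sum_bij' (fun τ _ => ⟨τ (Fin.last (m + 1)), fun i => τ i.castSucc⟩)
    (fun p _ => Fin.snoc (α := fun _ => ℕ) p.2 p.1) ?_ ?_ ?_ ?_ ?_
  · intro τ hτ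
    simp only [Finset.mem_filter, Fintype.mem_piFinset, Finset.mem_range, Finset.mem_sigma] at hτ ⊢
    refine ⟨hτ.1 _, fun i => hτ.2.1 (Fin.castSucc_lt_last i), fun i j hij => hτ.2.1 ?_, hτ.2.2⟩
    exact hij
  · rintro ⟨s, σ⟩ h
    simp only [Finset.mem_filter, Fintype.mem_piFinset, Finset.mem_range, Finset.mem_sigma] at h ⊢
    obtain ⟨hs, h1, h2, h3⟩ := h
    refine ⟨fun i => ?_, ?_, ?_⟩
    · refine Fin.lastCases ?_ (fun i => ?_) i
      · simpa using hs
      · simpa using (h1 i).trans hs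
    · rw [Fin.strictMono_iff_lt_succ]
      intro i
      refine Fin.lastCases ?_ (fun i => ?_) i
      · rw [Fin.succ_last, Fin.snoc_last, Fin.snoc_castSucc]
        exact h1 _
      · rw [Fin.succ_castSucc, Fin.snoc_castSucc, Fin.snoc_castSucc]
        exact h2 (Fin.castSucc_lt_succ)
    · rw [← Fin.castSucc_zero, Fin.snoc_castSucc]
      exact h3
  · intro τ _
    exact Fin.snoc_init_self (α := fun _ => ℕ) τ
  · rintro ⟨s, σ⟩ _
    simp
  · intro τ _
    simp only [Fin.prod_univ_castSucc, Fin.succ_last, Fin.succ_castSucc, Fin.castSucc_zero]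
    ring

lemma pathSum_vanish (U V : ℕ → ℝ) (m : ℕ) : ∀ n, n ≤ m + 1 → pathSum U V m n = 0 := by
  induction m with
  | zero =>
    intro n hn
    rw [pathSum_zero]
    refine Finset.sum_eq_zero fun s hs => ?_
    have : s = 0 := by simp at hs; omega
    simp [this]
  | succ m ih =>
    intro n hn
    rw [pathSum_succ]
    refine Finset.sum_eq_zero fun s hs => ?_
    rw [ih s (by simp at hs; omega), mul_zero]

/-- Twice the loss, shifted. -/
noncomputable def renW (U V : ℕ → ℝ) (n : ℕ) : ℝ :=
  (if n = 0 then 0 else V n) + ∑ m ∈ Finset.range (n - 1), pathSum U V m n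

lemma renW_eq (U V : ℕ → ℝ) (n M : ℕ) (h : n - 1 ≤ M) :
    renW U V n = (if n = 0 then 0 else V n) + ∑ m ∈ Finset.range M, pathSum U V m n := by
  unfold renW
  congr 1
  refine Finset.sum_subset (by simpa using h) fun m _ hm => pathSum_vanish U V m n ?_
  simp at hm; omega

lemma lossSeq_eq (U V : ℕ → ℝ) (t : ℕ) : lossSeq U V t = 1 / 2 * renW U V (t + 1) := by
  unfold lossSeq renW
  simp only [fin_sum_eq_pathSum]
  simp

lemma renW_rec (U V : ℕ → ℝ) (n : ℕ) :
    renW U V n = (if n = 0 then 0 else V n) + ∑ s ∈ Finset.range n, U (n - s) * renW U V s := by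
  rw [renW_eq U V n (n + 1) (by omega)]
  congr 1
  rw [Finset.sum_range_succ', pathSum_zero]
  simp_rw [pathSum_succ]
  rw [Finset.sum_comm, ← Finset.sum_add_distrib]
  refine Finset.sum_congr rfl fun s hs => ?_
  rw [renW_eq U V s n (by simp at hs; omega), ← Finset.mul_sum]
  ring

lemma volterra_tendsto_zero (K : ℕ → ℕ → ℝ) (d e : ℕ → ℝ) (q : ℝ) (hq : q < 1) (hq0 : 0 ≤ q)
    (hK : ∀ n s, s < n → 0 ≤ K n s)
    (hrow : ∀ᶠ n in atTop, ∑ s ∈ Finset.range n, K n s ≤ q)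
    (hcol : ∀ s, Tendsto (fun n => K n s) atTop (𝓝 0))
    (he : Tendsto e atTop (𝓝 0))
    (hd : ∀ᶠ n in atTop, d n = e n + ∑ s ∈ Finset.range n, K n s * d s) :
    Tendsto d atTop (𝓝 0) := by
  -- basic inequality
  have hineq : ∀ᶠ n in atTop, |d n| ≤ |e n| + ∑ s ∈ Finset.range n, K n s * |d s| := by
    filter_upwards [hd] with n hn
    rw [hn]
    refine (abs_add_le _ _).trans (add_le_add le_rfl ?_)
    refine (Finset.abs_sum_le_sum_abs _ _).trans (Finset.sum_le_sum fun s hs => ?_)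
    rw [abs_mul, abs_of_nonneg (hK n s (by simpa using hs))]
  -- boundedness
  obtain ⟨B, hB0, hB⟩ : ∃ B : ℝ, 0 ≤ B ∧ ∀ n, |d n| ≤ B := by
    have he1 : ∀ᶠ n in atTop, |e n| ≤ 1 := by
      have := he.abs
      simp only [abs_zero] at this
      exact this.eventually_le_const one_pos
    obtain ⟨N, hN⟩ := eventually_atTop.1 (hineq.and (hrow.and he1))
    set B := ∑ s ∈ Finset.range N, |d s| + 1 / (1 - q) with hBdef
    have h1q : 0 < 1 - q := by linarith
    have hS : 0 ≤ ∑ s ∈ Finset.range N, |d s| := Finset.sum_nonneg fun _ _ => abs_nonneg _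
    have hB1 : 1 / (1 - q) ≤ B := by linarith
    have hB0 : 0 ≤ B := le_trans (by positivity) hB1
    refine ⟨B, hB0, fun n => ?_⟩
    induction n using Nat.strong_induction_on with
    | _ n ih =>
      by_cases hn : n < N
      · have : |d n| ≤ ∑ s ∈ Finset.range N, |d s| :=
          Finset.single_le_sum (f := fun s => |d s|) (fun _ _ => abs_nonneg _) (by simpa using hn)
        have : 0 ≤ 1 / (1 - q) := by positivity
        linarith
      · obtain ⟨h1, h2, h3⟩ := hN n (by omega)
        have h4 : ∑ s ∈ Finset.range n, K n s * |d s| ≤ ∑ s ∈ Finset.range n, K n s * B :=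
          Finset.sum_le_sum fun s hs => mul_le_mul_of_nonneg_left (ih s (by simpa using hs))
            (hK n s (by simpa using hs))
        rw [← Finset.sum_mul] at h4
        have h5 := mul_le_mul_of_nonneg_right h2 hB0
        rw [div_le_iff₀ h1q] at hB1
        nlinarith
  have hbdd : IsBoundedUnder (· ≤ ·) atTop (fun n => |d n|) := isBoundedUnder_of ⟨B, hB⟩
  have hcob : IsCoboundedUnder (· ≤ ·) atTop (fun n => |d n|) :=
    (isBoundedUnder_of ⟨0, fun n => abs_nonneg _⟩ :
      IsBoundedUnder (· ≥ ·) atTop (fun n => |d n|)).isCoboundedUnder_le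
  set D := limsup (fun n => |d n|) atTop with hD
  have hkey : ∀ ε > 0, D ≤ q * D + 3 * ε := by
    intro ε hε
    have h1 : ∀ᶠ n in atTop, |d n| < D + ε := eventually_lt_of_limsup_lt (by linarith) hbdd
    obtain ⟨N, hN⟩ := eventually_atTop.1 h1
    have h2 : Tendsto (fun n => ∑ s ∈ Finset.range N, K n s * B) atTop (𝓝 0) := by
      have := tendsto_finsetSum (Finset.range N) (fun s _ => (hcol s).mul_const B)
      simpa using this
    have h3 := h2.eventually_le_const hε
    have h4 : ∀ᶠ n in atTop, |e n| ≤ ε := by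
      have := he.abs
      simp only [abs_zero] at this
      exact this.eventually_le_const hε
    have hDε : 0 ≤ D + ε := (abs_nonneg _).trans (hN N le_rfl).le
    refine limsup_le_of_le hcob ?_
    filter_upwards [hineq, hrow, h3, h4, eventually_ge_atTop N] with n i1 i2 i3 i4 i5
    have i6 : ∑ s ∈ Finset.range n, K n s * |d s|
        ≤ ∑ s ∈ Finset.range N, K n s * B + ∑ s ∈ Finset.range n, K n s * (D + ε) := by
      rw [← Finset.sum_range_add_sum_Ico _ i5]
      refine add_le_add (Finset.sum_le_sum fun s hs => ?_) ?_
      · exact mul_le_mul_of_nonneg_left (hB s) (hK n s (by simp at hs; omega))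
      · refine (Finset.sum_le_sum (g := fun s => K n s * (D + ε)) fun s hs => ?_).trans
          (Finset.sum_le_sum_of_subset_of_nonneg ?_ ?_)
        · simp only [Finset.mem_Ico] at hs
          exact mul_le_mul_of_nonneg_left (hN s hs.1).le (hK n s hs.2)
        · intro s hs
          simp at hs ⊢; omega
        · intro s hs _
          exact mul_nonneg (hK n s (by simpa using hs)) hDε
    have i7 := mul_le_mul_of_nonneg_right i2 hDε
    rw [Finset.sum_mul] at i7
    have i8 : q * ε ≤ ε := by nlinarith
    linarith
  have hD0 : D ≤ 0 := by
    by_contra! hpos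
    have := hkey ((1 - q) * D / 6) (by
      have : 0 < (1 - q) * D := mul_pos (by linarith) hpos
      linarith)
    have : 0 < (1 - q) * D := mul_pos (by linarith) hpos
    linarith
  rw [tendsto_zero_iff_abs_tendsto_zero]
  rw [Metric.tendsto_atTop]
  intro ε hε
  have h1 : ∀ᶠ n in atTop, |d n| < ε := eventually_lt_of_limsup_lt (by linarith) hbdd
  obtain ⟨N, hN⟩ := eventually_atTop.1 h1
  exact ⟨N, fun n hn => by simpa using hN n hn⟩

/-- The rescaled kernel. -/
noncomputable def renK (U : ℕ → ℝ) (ξ : ℝ) (n s : ℕ) : ℝ :=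
  U (n - s) * (n : ℝ) ^ ξ * (s : ℝ) ^ (-ξ)

lemma renK_bound (U : ℕ → ℝ) (ξ ξU C : ℝ) (hξ : 0 < ξ) (hξU : ξ < ξU) (hC : 0 ≤ C)
    (hUC : ∀ t : ℕ, 1 ≤ t → U t ≤ C * (t : ℝ) ^ (-ξU)) (n s : ℕ) (h : 2 * s < n) :
    renK U ξ n s ≤ C * 2 ^ ξU * (n : ℝ) ^ (-(ξU - ξ)) * (s : ℝ) ^ (-ξ) := by
  unfold renK
  have hn : (0 : ℝ) < n := by exact_mod_cast (by omega : 0 < n)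
  have h1 := hUC (n - s) (by omega)
  have h2 : ((n - s : ℕ) : ℝ) ^ (-ξU) ≤ ((n : ℝ) / 2) ^ (-ξU) := by
    refine Real.rpow_le_rpow_of_nonpos (by positivity) ?_ (by linarith)
    rw [div_le_iff₀ two_pos]
    exact_mod_cast (by omega : n ≤ (n - s) * 2)
  have h3 : ((n : ℝ) / 2) ^ (-ξU) = 2 ^ ξU * (n : ℝ) ^ (-ξU) := by
    rw [Real.div_rpow hn.le two_pos.le, Real.rpow_neg two_pos.le, div_inv_eq_mul, mul_comm]
  have h4 : (n : ℝ) ^ (-(ξU - ξ)) = (n : ℝ) ^ (-ξU) * (n : ℝ) ^ ξ := by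
    rw [← Real.rpow_add hn]; congr 1; ring
  rw [h4]
  have h5 : U (n - s) ≤ C * (2 ^ ξU * (n : ℝ) ^ (-ξU)) := by
    rw [← h3]; exact h1.trans (mul_le_mul_of_nonneg_left h2 hC)
  calc U (n - s) * (n : ℝ) ^ ξ * (s : ℝ) ^ (-ξ)
      ≤ C * (2 ^ ξU * (n : ℝ) ^ (-ξU)) * (n : ℝ) ^ ξ * (s : ℝ) ^ (-ξ) := by gcongr
    _ = _ := by ring

lemma renK_bound' (U : ℕ → ℝ) (ξ ξU C : ℝ) (hξ : 0 < ξ) (hξU : ξ < ξU) (hC : 0 ≤ C)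
    (hUC : ∀ t : ℕ, 1 ≤ t → U t ≤ C * (t : ℝ) ^ (-ξU)) (n s : ℕ) (h : 2 * s < n) :
    renK U ξ n s ≤ C * 2 ^ ξU * (s : ℝ) ^ (-ξU) := by
  rcases Nat.eq_zero_or_pos s with rfl | hs
  · have : (0 : ℝ) ^ (-ξ) = 0 := Real.zero_rpow (by linarith)
    have h2 : (0 : ℝ) ^ (-ξU) = 0 := Real.zero_rpow (by linarith)
    simp [renK, this, h2]
  · refine (renK_bound U ξ ξU C hξ hξU hC hUC n s h).trans ?_
    have hs' : (0 : ℝ) < s := by exact_mod_cast hs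
    have h1 : (n : ℝ) ^ (-(ξU - ξ)) ≤ (s : ℝ) ^ (-(ξU - ξ)) :=
      Real.rpow_le_rpow_of_nonpos hs' (by exact_mod_cast (by omega : s ≤ n)) (by linarith)
    have h2 : (s : ℝ) ^ (-ξU) = (s : ℝ) ^ (-(ξU - ξ)) * (s : ℝ) ^ (-ξ) := by
      rw [← Real.rpow_add hs']; congr 1; ring
    rw [h2, ← mul_assoc]
    gcongr

lemma renK_nonneg (U : ℕ → ℝ) (ξ : ℝ) (hU : ∀ t, 1 ≤ t → 0 ≤ U t) (n s : ℕ) (h : s < n) :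
    0 ≤ renK U ξ n s := by
  have := hU (n - s) (by omega)
  unfold renK
  positivity

lemma renK_col (U : ℕ → ℝ) (hU : ∀ t, 1 ≤ t → 0 ≤ U t)
    (ξ ξU C : ℝ) (hξ : 0 < ξ) (hξU : ξ < ξU) (hC : 0 ≤ C)
    (hUC : ∀ t : ℕ, 1 ≤ t → U t ≤ C * (t : ℝ) ^ (-ξU)) (s : ℕ) :
    Tendsto (fun n => renK U ξ n s) atTop (𝓝 0) := by
  have h1 : Tendsto (fun n : ℕ => C * 2 ^ ξU * (n : ℝ) ^ (-(ξU - ξ)) * (s : ℝ) ^ (-ξ))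
      atTop (𝓝 0) := by
    have := ((tendsto_rpow_neg_atTop (sub_pos.2 hξU)).comp tendsto_natCast_atTop_atTop).const_mul
      (C * 2 ^ ξU) |>.mul_const ((s : ℝ) ^ (-ξ))
    simpa using this
  refine tendsto_of_tendsto_of_tendsto_of_le_of_le' tendsto_const_nhds h1 ?_ ?_
  · filter_upwards [eventually_gt_atTop s] with n hn
    exact renK_nonneg U ξ hU n s hn
  · filter_upwards [eventually_gt_atTop (2 * s)] with n hn
    exact renK_bound U ξ ξU C hξ hξU hC hUC n s hn

lemma renK_row (U : ℕ → ℝ) (hU : ∀ t, 1 ≤ t → 0 ≤ U t)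
    (ξ ξU C : ℝ) (hξ : 0 < ξ) (hξU : ξ < ξU) (hξU1 : 1 < ξU) (hC : 0 ≤ C)
    (hUC : ∀ t : ℕ, 1 ≤ t → U t ≤ C * (t : ℝ) ^ (-ξU))
    (hs : Summable fun t => U (t + 1)) :
    Tendsto (fun n => ∑ s ∈ Finset.range n, renK U ξ n s) atTop (𝓝 (∑' t, U (t + 1))) := by
  have hA : Tendsto (fun n => ∑' s, if 2 * s < n then renK U ξ n s else 0) atTop
      (𝓝 (∑' _ : ℕ, (0 : ℝ))) := by
    refine tendsto_tsum_of_dominated_convergence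
      (bound := fun s : ℕ => C * 2 ^ ξU * (s : ℝ) ^ (-ξU)) ?_ ?_ ?_
    · exact (Real.summable_nat_rpow.2 (by linarith)).mul_left _
    · intro s
      refine (renK_col U hU ξ ξU C hξ hξU hC hUC s).congr' ?_
      filter_upwards [eventually_gt_atTop (2 * s)] with n hn
      simp [hn]
    · refine Eventually.of_forall fun n s => ?_
      split_ifs with h
      · rw [Real.norm_of_nonneg (renK_nonneg U ξ hU n s (by omega))]
        exact renK_bound' U ξ ξU C hξ hξU hC hUC n s h
      · rw [norm_zero]; positivity
  have hB : Tendsto (fun n => ∑' j, if 2 * (j + 1) ≤ n then renK U ξ n (n - 1 - j) else 0) atTop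
      (𝓝 (∑' j, U (j + 1))) := by
    refine tendsto_tsum_of_dominated_convergence
      (bound := fun j : ℕ => U (j + 1) * 2 ^ ξ) (hs.mul_right _) ?_ ?_
    · intro j
      have h1 : Tendsto (fun n : ℕ => (n : ℝ) / (n - (j + 1 : ℝ))) atTop (𝓝 1) := by
        have := tendsto_natCast_div_add_atTop (𝕜 := ℝ) (-(j + 1 : ℝ))
        simpa [sub_eq_add_neg] using this
      have h2 := (h1.rpow_const (p := ξ) (Or.inl one_ne_zero)).const_mul (U (j + 1))
      rw [Real.one_rpow, mul_one] at h2
      refine h2.congr' ?_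
      filter_upwards [eventually_ge_atTop (2 * (j + 1))] with n hn
      rw [if_pos hn, renK]
      have e1 : n - (n - 1 - j) = j + 1 := by omega
      have e2 : ((n - 1 - j : ℕ) : ℝ) = n - (j + 1 : ℝ) := by
        rw [show n - 1 - j = n - (j + 1) by omega, Nat.cast_sub (by omega)]; push_cast; ring
      have e3 : (0 : ℝ) ≤ n - (j + 1 : ℝ) := by rw [← e2]; positivity
      rw [e1, e2, Real.div_rpow (by positivity) e3, Real.rpow_neg e3]
      ring
    · refine Eventually.of_forall fun n j => ?_
      have hUj := hU (j + 1) (by omega)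
      split_ifs with h
      · rw [Real.norm_of_nonneg (renK_nonneg U ξ hU n _ (by omega)), renK,
          show n - (n - 1 - j) = j + 1 by omega, mul_assoc]
        refine mul_le_mul_of_nonneg_left ?_ hUj
        have hp : (0 : ℝ) < ((n - 1 - j : ℕ) : ℝ) := by exact_mod_cast (by omega : 0 < n - 1 - j)
        rw [Real.rpow_neg hp.le, ← div_eq_mul_inv, ← Real.div_rpow (by positivity) hp.le]
        refine Real.rpow_le_rpow (by positivity) ?_ hξ.le
        rw [div_le_iff₀ hp]
        exact_mod_cast (by omega : n ≤ 2 * (n - 1 - j))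
      · rw [norm_zero]; positivity
  have := hA.add hB
  rw [tsum_zero, zero_add] at this
  refine this.congr fun n => ?_
  rw [tsum_eq_sum (s := Finset.range n), tsum_eq_sum (s := Finset.range n)]
  · have h1 : ∑ j ∈ Finset.range n, (if 2 * (j + 1) ≤ n then renK U ξ n (n - 1 - j) else 0)
        = ∑ s ∈ Finset.range n, (if 2 * s < n then 0 else renK U ξ n s) := by
      rw [← Finset.sum_range_reflect]
      refine Finset.sum_congr rfl fun s hs => ?_
      simp only [Finset.mem_range] at hs
      rw [show n - 1 - (n - 1 - s) = s by omega]
      by_cases h : 2 * s < n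
      · rw [if_pos h, if_neg (by omega)]
      · rw [if_neg h, if_pos (by omega)]
    rw [h1, ← Finset.sum_add_distrib]
    refine Finset.sum_congr rfl fun s _ => ?_
    split_ifs <;> simp
  · intro j hj
    simp only [Finset.mem_range] at hj
    rw [if_neg (by omega)]
  · intro j hj
    simp only [Finset.mem_range] at hj
    rw [if_neg (by omega)]

/-- Signal-dominated regime: if `V_t = C_V·t^{−ξ_V}·(1+o(1))`, `U_Σ < 1` and
`U_t = O(t^{−ξ_U})` with `ξ_U > max(ξ_V, 1)`, then
`L_t = (C_V/(2(1−U_Σ)))·t^{−ξ_V}·(1+o(1))`. -/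
theorem stmt2 (U V : ℕ → ℝ)
    (hU : ∀ t, 1 ≤ t → 0 ≤ U t) (hV : ∀ t, 1 ≤ t → 0 ≤ V t)
    (ξV CV : ℝ) (hξV : 0 < ξV) (hCV : 0 < CV)
    (hVasymp : Tendsto (fun t : ℕ => V t * (t : ℝ) ^ ξV) atTop (𝓝 CV))
    (hUsum : ∑' t : ℕ, ENNReal.ofReal (U (t + 1)) < 1)
    (ξU : ℝ) (hξU : max ξV 1 < ξU)
    (hUbig : (fun t : ℕ => U t) =O[atTop] fun t : ℕ => (t : ℝ) ^ (-ξU)) :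
    Tendsto (fun t : ℕ => lossSeq U V t * (t : ℝ) ^ ξV) atTop
      (𝓝 (CV / (2 * (1 - (∑' t : ℕ, ENNReal.ofReal (U (t + 1))).toReal)))) := by
  have hUs : Summable fun t => U (t + 1) := by
    have h := ENNReal.summable_toReal (hUsum.trans ENNReal.one_lt_top).ne
    refine h.congr fun t => ?_
    exact ENNReal.toReal_ofReal (hU _ (by omega))
  have hρ : (∑' t : ℕ, ENNReal.ofReal (U (t + 1))).toReal = ∑' t, U (t + 1) := by
    rw [ENNReal.tsum_toReal_eq (fun _ => ENNReal.ofReal_ne_top)]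
    exact tsum_congr fun t => ENNReal.toReal_ofReal (hU _ (by omega))
  have hρ1 : ∑' t, U (t + 1) < 1 := by
    rw [← hρ, ← ENNReal.toReal_one]
    exact (ENNReal.toReal_lt_toReal (hUsum.trans ENNReal.one_lt_top).ne ENNReal.one_ne_top).2 hUsum
  have hρ0 : 0 ≤ ∑' t, U (t + 1) := tsum_nonneg fun t => hU _ (by omega)
  rw [hρ]
  set ρ := ∑' t, U (t + 1) with hρdef
  have hξ1 : ξV < ξU := (le_max_left _ _).trans_lt hξU
  have hξ2 : 1 < ξU := (le_max_right _ _).trans_lt hξU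
  obtain ⟨C, hC, hUC⟩ : ∃ C : ℝ, 0 ≤ C ∧ ∀ t : ℕ, 1 ≤ t → U t ≤ C * (t : ℝ) ^ (-ξU) := by
    obtain ⟨c, hc⟩ := hUbig.bound
    obtain ⟨N, hN⟩ := eventually_atTop.1 hc
    refine ⟨|c| + ∑ s ∈ Finset.range N, |U s * (s : ℝ) ^ ξU|, by positivity, fun t ht => ?_⟩
    have htp : (0 : ℝ) < t := by exact_mod_cast ht
    have hS : 0 ≤ ∑ s ∈ Finset.range N, |U s * (s : ℝ) ^ ξU| := by positivity
    by_cases h : t < N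
    · have h1 : |U t * (t : ℝ) ^ ξU| ≤ ∑ s ∈ Finset.range N, |U s * (s : ℝ) ^ ξU| :=
        Finset.single_le_sum (f := fun s : ℕ => |U s * (s : ℝ) ^ ξU|)
          (fun _ _ => abs_nonneg _) (by simpa using h)
      rw [Real.rpow_neg htp.le, ← div_eq_mul_inv, le_div_iff₀ (by positivity)]
      have := le_abs_self (U t * (t : ℝ) ^ ξU)
      have := abs_nonneg c
      linarith
    · have h1 := hN t (by omega)
      have h2 : (0 : ℝ) ≤ (t : ℝ) ^ (-ξU) := by positivity
      rw [Real.norm_of_nonneg h2] at h1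
      have h3 := le_abs_self (U t)
      rw [← Real.norm_eq_abs] at h3
      have h4 := le_abs_self c
      refine (h3.trans h1).trans (mul_le_mul_of_nonneg_right (by linarith) h2)
  have hrow := renK_row U hU ξV ξU C hξV hξ1 hξ2 hC hUC hUs
  have hcol := renK_col U hU ξV ξU C hξV hξ1 hC hUC
  set a : ℕ → ℝ := fun n => renW U V n * (n : ℝ) ^ ξV with ha
  have hrec : ∀ n : ℕ, 1 ≤ n →
      a n = V n * (n : ℝ) ^ ξV + ∑ s ∈ Finset.range n, renK U ξV n s * a s := by
    intro n hn
    simp only [ha]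
    rw [renW_rec, if_neg (by omega), add_mul, Finset.sum_mul]
    congr 1
    refine Finset.sum_congr rfl fun s _ => ?_
    rcases Nat.eq_zero_or_pos s with rfl | hs
    · simp [renW]
    · have hs' : (0 : ℝ) < s := by exact_mod_cast hs
      have : (s : ℝ) ^ (-ξV) * (s : ℝ) ^ ξV = 1 := by
        rw [← Real.rpow_add hs', neg_add_cancel, Real.rpow_zero]
      unfold renK
      linear_combination (-U (n - s) * (n : ℝ) ^ ξV * renW U V s) * this
  have h1ρ : 0 < 1 - ρ := by linarith
  set α := CV / (1 - ρ) with hα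
  have hd : Tendsto (fun n => a n - α) atTop (𝓝 0) := by
    refine volterra_tendsto_zero (renK U ξV) _
      (fun n => V n * (n : ℝ) ^ ξV - α + α * ∑ s ∈ Finset.range n, renK U ξV n s)
      ((1 + ρ) / 2) (by linarith) (by linarith) (renK_nonneg U ξV hU)
      (hrow.eventually_le_const (by linarith)) hcol ?_ ?_
    · have := (hVasymp.sub_const α).add (hrow.const_mul α)
      convert this using 2
      rw [hα]; field_simp; ring
    · filter_upwards [eventually_ge_atTop 1] with n hn
      rw [hrec n hn]
      simp only [mul_sub, Finset.sum_sub_distrib, ← Finset.sum_mul]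
      ring
  have haα : Tendsto a atTop (𝓝 α) := by simpa using hd.add_const α
  have h1 : Tendsto (fun t : ℕ => ((t : ℝ) / (t + 1)) ^ ξV) atTop (𝓝 1) := by
    have := (tendsto_natCast_div_add_atTop (𝕜 := ℝ) 1).rpow_const (p := ξV) (Or.inl one_ne_zero)
    simpa using this
  have h2 := (((tendsto_add_atTop_iff_nat 1).2 haα).const_mul (1 / 2)).mul h1
  have h3 : 1 / 2 * α * 1 = CV / (2 * (1 - ρ)) := by rw [hα]; field_simp
  rw [h3] at h2
  refine h2.congr fun t => ?_
  have ht : (0 : ℝ) < (t + 1 : ℝ) := by positivity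
  rw [lossSeq_eq, Real.div_rpow (by positivity) ht.le]
  simp only [ha]
  push_cast
  have : ((t : ℝ) + 1) ^ ξV ≠ 0 := by positivity
  field_simp
end

section
/- Assume there exist constants ξ_V > ξ_U > 1 and C_U > 0 such that U_t = C_U·t^{−ξ_U}·(1+o(1)) and V_t = O(t^{−ξ_V}) as t → ∞, and that U_Σ < 1. Then L_t = (V_Σ·C_U/(2(1−U_Σ)²))·t^{−ξ_U}·(1+o(1)) as t → ∞. -/
open Filter Topology Asymptotics
open scoped Classical

/-- admissible tuples, natural number valued -/
noncomputable def tupS (m n : ℕ) : Finset (Fin (m + 1) → ℕ) :=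
  (Fintype.piFinset (fun _ : Fin (m + 1) => Finset.range n)).filter
    (fun τ => StrictMono τ ∧ 0 < τ 0)

lemma mem_tupS {m n : ℕ} {τ : Fin (m + 1) → ℕ} :
    τ ∈ tupS m n ↔ (∀ i, τ i < n) ∧ StrictMono τ ∧ 0 < τ 0 := by
  simp [tupS]

noncomputable def tupW (U V : ℕ → ℝ) (m n : ℕ) : ℝ :=
  ∑ τ ∈ tupS m n, U (n - τ (Fin.last m)) *
    (∏ j : Fin m, U (τ j.succ - τ j.castSucc)) * V (τ 0)

lemma tupW_eq (U V : ℕ → ℝ) (m n : ℕ) :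
    ∑ τ ∈ Finset.univ.filter
          (fun τ : Fin (m + 1) → Fin n => StrictMono τ ∧ 0 < (τ 0 : ℕ)),
        U (n - (τ (Fin.last m) : ℕ)) *
          (∏ j : Fin m, U ((τ j.succ : ℕ) - (τ j.castSucc : ℕ))) * V (τ 0) = tupW U V m n := by
  unfold tupW
  refine Finset.sum_bij (fun τ _ => fun j => (τ j : ℕ)) ?_ ?_ ?_ ?_
  · intro τ hτ
    simp only [Finset.mem_filter, Finset.mem_univ, true_and] at hτ
    exact mem_tupS.2 ⟨fun i => (τ i).2, fun a b h => hτ.1 h, hτ.2⟩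
  · intro a _ b _ h
    funext j
    exact Fin.ext (congrFun h j)
  · intro σ hσ
    obtain ⟨h1, h2, h3⟩ := mem_tupS.1 hσ
    refine ⟨fun j => ⟨σ j, h1 j⟩, ?_, rfl⟩
    simp only [Finset.mem_filter, Finset.mem_univ, true_and]
    exact ⟨fun a b h => h2 h, h3⟩
  · intro τ _
    rfl

lemma tupW_zero_of_le (U V : ℕ → ℝ) (m n : ℕ) (h : n ≤ m + 1) : tupW U V m n = 0 := by
  unfold tupW
  rw [Finset.sum_eq_zero]
  intro τ hτ
  exfalso
  obtain ⟨h1, h2, h3⟩ := mem_tupS.1 hτ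
  have key : ∀ k : ℕ, ∀ hk : k < m + 1, k + 1 ≤ τ ⟨k, hk⟩ := by
    intro k
    induction k with
    | zero => intro hk; exact h3
    | succ k ih =>
      intro hk
      have a := ih (by omega)
      have b : τ ⟨k, by omega⟩ < τ ⟨k + 1, hk⟩ := h2 (by simp [Fin.lt_def])
      omega
  have a := key m (by omega)
  have b := h1 ⟨m, by omega⟩
  omega

lemma tupW_base (U V : ℕ → ℝ) (n : ℕ) :
    tupW U V 0 n = ∑ s ∈ Finset.range n, U (n - s) * (if s = 0 then 0 else V s) := by
  unfold tupW
  have : ∑ s ∈ Finset.range n, U (n - s) * (if s = 0 then 0 else V s)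
      = ∑ s ∈ (Finset.range n).filter (fun s => s ≠ 0), U (n - s) * V s := by
    rw [Finset.sum_filter]
    refine Finset.sum_congr rfl fun s _ => ?_
    by_cases h : s = 0 <;> simp [h]
  rw [this]
  refine Finset.sum_bij (fun τ _ => τ 0) ?_ ?_ ?_ ?_
  · intro τ hτ
    obtain ⟨h1, h2, h3⟩ := mem_tupS.1 hτ
    simp [h1 0, h3.ne']
  · intro a _ b _ h
    funext j
    have hj : j = 0 := Fin.ext (by omega)
    rw [hj]
    exact h
  · intro s hs
    simp only [Finset.mem_filter, Finset.mem_range] at hs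
    refine ⟨fun _ => s, mem_tupS.2 ⟨fun _ => hs.1, ?_, Nat.pos_of_ne_zero hs.2⟩, rfl⟩
    intro a b h
    exfalso
    have h' : a.val < b.val := h
    omega
  · intro τ _
    simp

lemma tupW_succ (U V : ℕ → ℝ) (m n : ℕ) :
    tupW U V (m + 1) n = ∑ s ∈ Finset.range n, U (n - s) * tupW U V m s := by
  unfold tupW
  simp_rw [Finset.mul_sum]
  rw [Finset.sum_sigma']
  symm
  refine Finset.sum_bij' (fun p _ => (Fin.snoc p.2 p.1 : Fin (m + 1 + 1) → ℕ))
    (fun τ _ => (⟨τ (Fin.last (m + 1)), Fin.init τ⟩ : (_ : ℕ) × (Fin (m + 1) → ℕ))) ?_ ?_ ?_ ?_ ?_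
  · rintro ⟨s, σ⟩ h
    simp only [Finset.mem_sigma, Finset.mem_range, mem_tupS] at h ⊢
    obtain ⟨hs, h1, h2, h3⟩ := h
    refine ⟨?_, ?_, ?_⟩
    · intro i
      refine Fin.lastCases ?_ (fun i => ?_) i
      · simpa using hs
      · simpa using (h1 i).trans hs
    · rw [Fin.strictMono_iff_lt_succ]
      intro i
      refine Fin.lastCases ?_ (fun i => ?_) i
      · simpa using h1 (Fin.last m)
      · rw [Fin.snoc_castSucc, Fin.succ_castSucc, Fin.snoc_castSucc]
        exact h2 (Fin.castSucc_lt_succ)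
    · rw [← Fin.castSucc_zero, Fin.snoc_castSucc]
      exact h3
  · intro τ h
    simp only [Finset.mem_sigma, Finset.mem_range, mem_tupS] at h ⊢
    obtain ⟨h1, h2, h3⟩ := h
    refine ⟨h1 _, fun i => h2 (Fin.castSucc_lt_last i), fun a b hab => h2 (by simpa using hab), ?_⟩
    simpa [Fin.init] using h3
  · rintro ⟨s, σ⟩ h
    simp
  · intro τ h
    simp
  · rintro ⟨s, σ⟩ h
    simp only
    rw [Fin.prod_univ_castSucc]
    have e0 : (Fin.snoc σ s : Fin (m + 1 + 1) → ℕ) 0 = σ 0 := by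
      rw [← Fin.castSucc_zero, Fin.snoc_castSucc]
    rw [e0]
    simp only [Fin.succ_castSucc, Fin.snoc_castSucc, Fin.succ_last, Fin.snoc_last]
    ring

noncomputable def renX (U V : ℕ → ℝ) (n : ℕ) : ℝ :=
  (if n = 0 then 0 else V n) + ∑ m ∈ Finset.range n, tupW U V m n

lemma renX_eq (U V : ℕ → ℝ) (n M : ℕ) (h : n ≤ M + 1) :
    renX U V n = (if n = 0 then 0 else V n) + ∑ m ∈ Finset.range M, tupW U V m n := by
  unfold renX
  congr 1
  rcases Nat.lt_or_ge M n with h' | h'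
  · have : n = M + 1 := by omega
    subst this
    rw [Finset.sum_range_succ, tupW_zero_of_le U V M (M + 1) le_rfl, add_zero]
  · refine Finset.sum_subset (by simpa using h') ?_
    intro m _ hm
    exact tupW_zero_of_le U V m n (by simp at hm; omega)

lemma renX_loss (U V : ℕ → ℝ) (t : ℕ) : lossSeq U V t = (1 / 2) * renX U V (t + 1) := by
  rw [renX_eq U V (t + 1) t le_rfl]
  unfold lossSeq
  simp only [tupW_eq, Nat.succ_ne_zero, if_false]

lemma renX_rec (U V : ℕ → ℝ) (n : ℕ) :
    renX U V n = (if n = 0 then 0 else V n) + ∑ s ∈ Finset.range n, U (n - s) * renX U V s := by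
  rcases Nat.eq_zero_or_pos n with h | h
  · subst h; simp [renX]
  obtain ⟨k, rfl⟩ : ∃ k, n = k + 1 := ⟨n - 1, by omega⟩
  rw [renX]
  congr 1
  rw [Finset.sum_range_succ', tupW_base]
  simp_rw [tupW_succ]
  rw [Finset.sum_comm, ← Finset.sum_add_distrib]
  refine Finset.sum_congr rfl fun s hs => ?_
  rw [renX_eq U V s k (by simp at hs; omega), mul_add, Finset.mul_sum]
  ring

section analytic

variable {u v x : ℕ → ℝ} {ξ C : ℝ}

lemma ren_nonneg (hu : ∀ n, 0 ≤ u n) (hv : ∀ n, 0 ≤ v n)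
    (hx : ∀ n, x n = v n + ∑ s ∈ Finset.range n, u (n - s) * x s) (n : ℕ) : 0 ≤ x n := by
  induction n using Nat.strong_induction_on with
  | _ n ih =>
    rw [hx]
    exact add_nonneg (hv n) (Finset.sum_nonneg fun s hs =>
      mul_nonneg (hu _) (ih s (Finset.mem_range.1 hs)))

lemma ren_summable (hu : ∀ n, 0 ≤ u n) (hv : ∀ n, 0 ≤ v n) (hu0 : u 0 = 0)
    (hx : ∀ n, x n = v n + ∑ s ∈ Finset.range n, u (n - s) * x s)
    (hus : Summable u) (hvs : Summable v) (hu1 : ∑' n, u n < 1) :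
    Summable x ∧ ∑' n, x n = (∑' n, v n) / (1 - ∑' n, u n) := by
  have hx0 := ren_nonneg hu hv hx
  have hx' : ∀ n, x n = v n + ∑ p ∈ Finset.HasAntidiagonal.antidiagonal n, x p.1 * u p.2 := by
    intro n
    rw [Finset.Nat.sum_antidiagonal_eq_sum_range_succ (fun a b => x a * u b),
      Finset.sum_range_succ, Nat.sub_self, hu0, mul_zero, add_zero, hx n]
    simp_rw [mul_comm]
  have hs : Summable x := by
    refine summable_of_sum_range_le (c := (∑' n, v n) / (1 - ∑' n, u n)) hx0 ?_
    intro N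
    rw [le_div_iff₀ (by linarith)]
    have h1 : ∑ n ∈ Finset.range N, x n ≤ ∑' n, v n
        + (∑' n, u n) * ∑ n ∈ Finset.range N, x n := by
      calc ∑ n ∈ Finset.range N, x n
          = ∑ n ∈ Finset.range N, v n
            + ∑ n ∈ Finset.range N, ∑ s ∈ Finset.range n, u (n - s) * x s := by
            rw [← Finset.sum_add_distrib]
            exact Finset.sum_congr rfl fun n _ => hx n
        _ ≤ _ := by
            refine add_le_add (hvs.sum_le_tsum _ fun i _ => hv i) ?_
            have : ∑ n ∈ Finset.range N, ∑ s ∈ Finset.range n, u (n - s) * x s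
                ≤ ∑ n ∈ Finset.range N, ∑ s ∈ Finset.range N,
                  (if s ≤ n then u (n - s) * x s else 0) := by
              refine Finset.sum_le_sum fun n hn => ?_
              rw [← Finset.sum_filter]
              refine Finset.sum_le_sum_of_subset_of_nonneg ?_ ?_
              · intro s hs
                simp at hs hn ⊢
                omega
              · intro s _ _
                exact mul_nonneg (hu _) (hx0 _)
            refine this.trans ?_
            rw [Finset.sum_comm, Finset.mul_sum]
            refine Finset.sum_le_sum fun s hs => ?_
            have e : ∑ n ∈ Finset.range N, (if s ≤ n then u (n - s) * x s else 0)
                = (∑ n ∈ (Finset.range N).filter (fun n => s ≤ n), u (n - s)) * x s := by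
              rw [← Finset.sum_filter, Finset.sum_mul]
            rw [e]
            refine mul_le_mul_of_nonneg_right ?_ (hx0 s)
            rw [← Finset.sum_image (f := u) (g := fun n => n - s)]
            · exact hus.sum_le_tsum _ fun i _ => hu i
            · intro a ha b hb hab
              simp at ha hb hab
              omega
    nlinarith
  refine ⟨hs, ?_⟩
  have hp := tsum_mul_tsum_eq_tsum_sum_antidiagonal_of_summable_norm hs.norm hus.norm
  have hps := (summable_norm_sum_mul_antidiagonal_of_summable_norm hs.norm hus.norm).of_norm
  have : ∑' n, x n = ∑' n, v n + (∑' n, x n) * ∑' n, u n := by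
    rw [hp, ← hvs.tsum_add hps]
    exact tsum_congr hx'
  rw [eq_div_iff (by linarith)]
  linarith

lemma ren_ratio (ξ : ℝ) (j : ℕ) :
    Tendsto (fun n : ℕ => ((n : ℝ) / ((n - j : ℕ) : ℝ)) ^ ξ) atTop (𝓝 1) := by
  have h : Tendsto (fun n : ℕ => (n : ℝ) / ((n - j : ℕ) : ℝ)) atTop (𝓝 1) := by
    rw [← tendsto_add_atTop_iff_nat j]
    have := (tendsto_const_div_atTop_nhds_zero_nat (j : ℝ)).const_add 1
    rw [add_zero] at this
    refine this.congr' ?_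
    filter_upwards [eventually_gt_atTop 0] with n hn
    have : (n : ℝ) ≠ 0 := by positivity
    simp only [Nat.add_sub_cancel, Nat.cast_add]
    field_simp
  simpa using h.rpow_const (p := ξ) (Or.inl one_ne_zero)

lemma ren_ratio_le {ξ : ℝ} (hξ : 1 < ξ) {n j : ℕ} (h : 2 * j ≤ n) :
    ((n : ℝ) / ((n - j : ℕ) : ℝ)) ^ ξ ≤ 2 ^ ξ := by
  refine Real.rpow_le_rpow (by positivity) ?_ (by linarith)
  rcases Nat.eq_zero_or_pos n with h0 | h0
  · subst h0; simp
  have : 0 < n - j := by omega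
  rw [div_le_iff₀ (by positivity)]
  exact_mod_cast (by omega : n ≤ 2 * (n - j))

lemma ren_split {n j : ℕ} (h : 2 * j ≤ n) (hn : 0 < n) (ξ : ℝ) :
    (n : ℝ) ^ ξ = ((n - j : ℕ) : ℝ) ^ ξ * ((n : ℝ) / ((n - j : ℕ) : ℝ)) ^ ξ := by
  have : 0 < n - j := by omega
  rw [← Real.mul_rpow (by positivity) (by positivity)]
  congr 1
  field_simp

lemma ren_main (hu : ∀ n, 0 ≤ u n) (hv : ∀ n, 0 ≤ v n) (hu0 : u 0 = 0)
    (hx : ∀ n, x n = v n + ∑ s ∈ Finset.range n, u (n - s) * x s)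
    (hus : Summable u) (hvs : Summable v) (hu1 : ∑' n, u n < 1) (hξ : 1 < ξ)
    (hua : Tendsto (fun n : ℕ => u n * (n : ℝ) ^ ξ) atTop (𝓝 C))
    (hva : Tendsto (fun n : ℕ => v n * (n : ℝ) ^ ξ) atTop (𝓝 0)) :
    Tendsto (fun n : ℕ => x n * (n : ℝ) ^ ξ) atTop
      (𝓝 ((∑' n, v n) * C / (1 - ∑' n, u n) ^ 2)) := by
  have hx0 := ren_nonneg hu hv hx
  obtain ⟨hxs, hxt⟩ := ren_summable hu hv hu0 hx hus hvs hu1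
  set A := ∑' n, u n with hA
  have hA0 : 0 ≤ A := tsum_nonneg hu
  set X := ∑' n, x n with hX
  obtain ⟨K, hK⟩ := hua.bddAbove_range
  have hK : ∀ n : ℕ, u n * (n : ℝ) ^ ξ ≤ K := fun n => hK ⟨n, rfl⟩
  -- the part with small s
  set f : ℕ → ℕ → ℝ := fun n j => if 2 * j < n then u (n - j) * x j * (n : ℝ) ^ ξ else 0 with hf
  have hfl : Tendsto (fun n => ∑' j, f n j) atTop (𝓝 (∑' j, x j * C)) := by
    refine tendsto_tsum_of_dominated_convergence (bound := fun j => x j * (K * 2 ^ ξ))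
      (hxs.mul_right _) ?_ ?_
    · intro j
      have h1 := ((hua.comp (tendsto_sub_atTop_nat j)).mul (ren_ratio ξ j)).const_mul (x j)
      rw [mul_one] at h1
      refine h1.congr' ?_
      filter_upwards [eventually_gt_atTop (2 * j)] with n hn
      simp only [hf, if_pos hn, Function.comp]
      rw [ren_split hn.le (by omega) ξ]
      ring
    · refine Eventually.of_forall fun n j => ?_
      have hK0 : 0 ≤ K := le_trans (mul_nonneg (hu 0) (by positivity)) (hK 0)
      simp only [hf]
      split_ifs with h
      · rw [Real.norm_of_nonneg (mul_nonneg (mul_nonneg (hu _) (hx0 _)) (by positivity)),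
          ren_split h.le (by omega) ξ]
        have h2 := mul_le_mul (hK (n - j)) (ren_ratio_le hξ h.le) (by positivity) hK0
        have h3 := mul_le_mul_of_nonneg_left h2 (hx0 j)
        refine le_of_eq_of_le ?_ h3
        ring
      · rw [norm_zero]
        exact mul_nonneg (hx0 j) (by positivity)
  rw [tsum_mul_right] at hfl
  set g : ℕ → ℕ → ℝ := fun n i =>
    if 2 * i ≤ n then u i * ((n : ℝ) / ((n - i : ℕ) : ℝ)) ^ ξ else 0 with hg
  have hg0 : ∀ n i, 0 ≤ g n i := by
    intro n i
    simp only [hg]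
    split_ifs
    · exact mul_nonneg (hu _) (by positivity)
    · exact le_rfl
  have hgl : Tendsto (fun n => ∑' j, g n j) atTop (𝓝 A) := by
    refine tendsto_tsum_of_dominated_convergence (bound := fun j => u j * 2 ^ ξ)
      (hus.mul_right _) ?_ ?_
    · intro j
      have h1 := (ren_ratio ξ j).const_mul (u j)
      rw [mul_one] at h1
      refine h1.congr' ?_
      filter_upwards [eventually_ge_atTop (2 * j)] with n hn
      simp only [hg, if_pos hn]
    · refine Eventually.of_forall fun n j => ?_
      rw [Real.norm_of_nonneg (hg0 n j)]
      simp only [hg]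
      split_ifs with h
      · exact mul_le_mul_of_nonneg_left (ren_ratio_le hξ h) (hu j)
      · exact mul_nonneg (hu j) (by positivity)
  set y : ℕ → ℝ := fun n => x n * (n : ℝ) ^ ξ with hy
  have hy0 : ∀ n, 0 ≤ y n := fun n => mul_nonneg (hx0 n) (by positivity)
  set F : ℕ → ℝ := fun n => ∑' j, f n j with hF
  set r : ℕ → ℝ := fun n => ∑' j, g n j with hr
  have hrs : ∀ n, r n = ∑ i ∈ Finset.range (n + 1), g n i := by
    intro n
    refine tsum_eq_sum fun i hi => ?_
    simp only [hg]
    rw [if_neg]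
    simp at hi
    omega
  have hFs : ∀ n, F n = ∑ i ∈ Finset.range (n + 1), f n i := by
    intro n
    refine tsum_eq_sum fun i hi => ?_
    simp only [hf]
    rw [if_neg]
    simp at hi
    omega
  set h : ℕ → ℝ := fun n => v n * (n : ℝ) ^ ξ + F n with hh
  have hhl : Tendsto h atTop (𝓝 (X * C)) := by
    have := hva.add hfl
    rwa [zero_add] at this
  have hyrec : ∀ n, 0 < n → y n = h n + ∑ i ∈ Finset.range (n + 1), g n i * y (n - i) := by
    intro n hn
    have e1 : ∑ i ∈ Finset.range (n + 1), g n i * y (n - i)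
        = ∑ s ∈ Finset.range (n + 1), if 2 * s < n then 0 else u (n - s) * x s * (n : ℝ) ^ ξ := by
      rw [← Finset.sum_range_reflect]
      refine Finset.sum_congr rfl fun s hs => ?_
      have hs' : s ≤ n := by simp at hs; omega
      have e : n + 1 - 1 - s = n - s := by omega
      have e' : n - (n - s) = s := by omega
      rw [e, e']
      by_cases h2 : 2 * s < n
      · simp only [hg]
        rw [if_pos h2, if_neg (by omega), zero_mul]
      · simp only [hg, hy]
        rw [if_neg h2, if_pos (by omega), ren_split (j := n - s) (by omega) hn ξ, e']
        ring
    rw [e1]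
    simp only [hh, hFs, hf]
    rw [add_assoc, ← Finset.sum_add_distrib]
    have e2 : ∀ s ∈ Finset.range (n + 1), ((if 2 * s < n then u (n - s) * x s * (n : ℝ) ^ ξ else 0)
        + (if 2 * s < n then 0 else u (n - s) * x s * (n : ℝ) ^ ξ))
        = u (n - s) * x s * (n : ℝ) ^ ξ := by
      intro s _
      split_ifs <;> simp
    rw [Finset.sum_congr rfl e2, ← Finset.sum_mul, Finset.sum_range_succ, Nat.sub_self, hu0]
    simp only [hy]
    rw [hx n]
    ring
  set c := X * C / (1 - A) with hc
  have hA1 : 0 < 1 - A := by linarith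
  have hgoal : (∑' n, v n) * C / (1 - A) ^ 2 = c := by
    rw [hc, hxt]
    field_simp
  rw [hgoal]
  set ρ := (1 + A) / 2 with hρ
  have hρ1 : ρ < 1 := by rw [hρ]; linarith
  have hρA : A < ρ := by rw [hρ]; linarith
  have hρ0 : 0 < ρ := by linarith
  -- boundedness
  have hbdd : ∃ B, ∀ n, y n ≤ B := by
    have ev := ((hgl.eventually_le_const hρA).and
      (hhl.eventually_le_const (lt_add_one (X * C)))).and (eventually_gt_atTop 0)
    obtain ⟨N, hN⟩ := eventually_atTop.1 ev
    set B := max (∑ m ∈ Finset.range N, y m) ((X * C + 1) / (1 - ρ)) with hB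
    have hB0 : 0 ≤ B := le_max_of_le_left (Finset.sum_nonneg fun m _ => hy0 m)
    refine ⟨B, fun n => ?_⟩
    induction n using Nat.strong_induction_on with
    | _ n ih =>
      rcases Nat.lt_or_ge n N with hn | hn
      · exact le_max_of_le_left
          (Finset.single_le_sum (fun m _ => hy0 m) (Finset.mem_range.2 hn))
      · obtain ⟨⟨h1, h2⟩, h3⟩ := hN n hn
        rw [hyrec n h3]
        have h4 : ∑ i ∈ Finset.range (n + 1), g n i * y (n - i) ≤ r n * B := by
          rw [hrs, Finset.sum_mul]
          refine Finset.sum_le_sum fun i hi => ?_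
          rcases Nat.eq_zero_or_pos i with hi0 | hi0
          · subst hi0
            simp [hg, hu0]
          · exact mul_le_mul_of_nonneg_left (ih _ (by omega)) (hg0 _ _)
        have h5 : r n * B ≤ ρ * B := mul_le_mul_of_nonneg_right h1 hB0
        have h6 : (X * C + 1) / (1 - ρ) ≤ B := le_max_right _ _
        rw [div_le_iff₀ (by linarith)] at h6
        nlinarith
  obtain ⟨B, hB⟩ := hbdd
  have hcontr : ∀ D, 0 < D → (∀ᶠ n in atTop, |y n - c| ≤ D) →
      ∀ᶠ n in atTop, |y n - c| ≤ ρ * D := by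
    intro D hD hev
    obtain ⟨N, hN⟩ := eventually_atTop.1 hev
    have t1 : Tendsto (fun n => |h n + c * r n - c| + r n * D) atTop
        (𝓝 (|X * C + c * A - c| + A * D)) :=
      (((hhl.add (hgl.const_mul c)).sub_const c).abs).add (hgl.mul_const D)
    have e : X * C + c * A - c = 0 := by
      have : c * (1 - A) = X * C := by rw [hc]; field_simp
      linarith
    rw [e, abs_zero, zero_add] at t1
    filter_upwards [t1.eventually_le_const (mul_lt_mul_of_pos_right hρA hD),
      eventually_gt_atTop 0, eventually_ge_atTop (2 * N)] with n h1 h2 h3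
    refine le_trans ?_ h1
    have e2 : y n - c = (h n + c * r n - c)
        + ∑ i ∈ Finset.range (n + 1), g n i * (y (n - i) - c) := by
      simp_rw [mul_sub]
      rw [Finset.sum_sub_distrib, ← Finset.sum_mul, ← hrs, hyrec n h2]
      ring
    rw [e2]
    refine (abs_add_le _ _).trans (add_le_add le_rfl ?_)
    refine (Finset.abs_sum_le_sum_abs _ _).trans ?_
    rw [hrs, Finset.sum_mul]
    refine Finset.sum_le_sum fun i hi => ?_
    rw [abs_mul, abs_of_nonneg (hg0 n i)]
    by_cases hi2 : 2 * i ≤ n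
    · exact mul_le_mul_of_nonneg_left (hN _ (by omega)) (hg0 _ _)
    · have : g n i = 0 := by simp only [hg]; rw [if_neg hi2]
      rw [this]; simp
  set D0 := |B| + |c| + 1 with hD0
  have hD0p : 0 < D0 := by positivity
  have hiter : ∀ k : ℕ, ∀ᶠ n in atTop, |y n - c| ≤ ρ ^ k * D0 := by
    intro k
    induction k with
    | zero =>
      refine Eventually.of_forall fun n => ?_
      have a1 := abs_sub (y n) c
      rw [abs_of_nonneg (hy0 n)] at a1
      have a2 := (hB n).trans (le_abs_self B)
      rw [pow_zero, one_mul]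
      linarith
    | succ k ih =>
      have := hcontr _ (by positivity) ih
      filter_upwards [this] with n hn
      rw [pow_succ']
      linarith
  rw [Metric.tendsto_nhds]
  intro ε hε
  have hpow : Tendsto (fun k : ℕ => ρ ^ k * D0) atTop (𝓝 0) := by
    simpa using (tendsto_pow_atTop_nhds_zero_of_lt_one hρ0.le hρ1).mul_const D0
  obtain ⟨k, hk⟩ := (hpow.eventually_lt_const hε).exists
  filter_upwards [hiter k] with n hn
  rw [Real.dist_eq]
  exact hn.trans_lt hk

end analytic

/-- Noise-dominated regime: if `U_t = C_U·t^{−ξ_U}·(1+o(1))`,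
`V_t = O(t^{−ξ_V})` with `ξ_V > ξ_U > 1`, and `U_Σ < 1`, then
`L_t = (V_Σ·C_U/(2(1−U_Σ)²))·t^{−ξ_U}·(1+o(1))`. -/
theorem stmt3 (U V : ℕ → ℝ)
    (hU : ∀ t, 1 ≤ t → 0 ≤ U t) (hV : ∀ t, 1 ≤ t → 0 ≤ V t)
    (ξU ξV CU : ℝ) (hξU : 1 < ξU) (hξVU : ξU < ξV) (hCU : 0 < CU)
    (hUasymp : Tendsto (fun t : ℕ => U t * (t : ℝ) ^ ξU) atTop (𝓝 CU))
    (hVbig : (fun t : ℕ => V t) =O[atTop] fun t : ℕ => (t : ℝ) ^ (-ξV))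
    (hUsum : ∑' t : ℕ, ENNReal.ofReal (U (t + 1)) < 1) :
    Tendsto (fun t : ℕ => lossSeq U V t * (t : ℝ) ^ ξU) atTop
      (𝓝 ((∑' t : ℕ, ENNReal.ofReal (V (t + 1))).toReal * CU /
        (2 * (1 - (∑' t : ℕ, ENNReal.ofReal (U (t + 1))).toReal) ^ 2))) := by
  set u : ℕ → ℝ := fun n => if n = 0 then 0 else U n with hu_def
  set v : ℕ → ℝ := fun n => if n = 0 then 0 else V n with hv_def
  have hu : ∀ n, 0 ≤ u n := by
    intro n
    by_cases h : n = 0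
    · simp [hu_def, h]
    · simpa [hu_def, h] using hU n (by omega)
  have hv : ∀ n, 0 ≤ v n := by
    intro n
    by_cases h : n = 0
    · simp [hv_def, h]
    · simpa [hv_def, h] using hV n (by omega)
  have hu0 : u 0 = 0 := by simp [hu_def]
  have hv0 : v 0 = 0 := by simp [hv_def]
  have huU : ∀ᶠ n in atTop, U n = u n := by
    filter_upwards [eventually_gt_atTop 0] with n hn
    simp [hu_def, hn.ne']
  have hvV : ∀ᶠ n in atTop, V n = v n := by
    filter_upwards [eventually_gt_atTop 0] with n hn
    simp [hv_def, hn.ne']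
  have hvbig : v =O[atTop] fun t : ℕ => (t : ℝ) ^ (-ξV) := hVbig.congr' hvV EventuallyEq.rfl
  have hvs : Summable v :=
    summable_of_isBigO_nat (Real.summable_nat_rpow.2 (by linarith)) hvbig
  have husS : Summable (fun t => U (t + 1)) := by
    have h1 := ENNReal.summable_toReal hUsum.ne_top
    refine h1.congr fun t => ?_
    rw [ENNReal.toReal_ofReal (hU _ (by omega))]
  have hus : Summable u := by
    rw [← summable_nat_add_iff 1]
    simpa [hu_def] using husS
  have eU : (∑' t : ℕ, ENNReal.ofReal (U (t + 1))).toReal = ∑' n, u n := by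
    rw [← ENNReal.ofReal_tsum_of_nonneg (fun n => hU _ (by omega)) husS,
      ENNReal.toReal_ofReal (tsum_nonneg fun n => hU _ (by omega)), hus.tsum_eq_zero_add, hu0,
      zero_add]
    simp [hu_def]
  have hvsS : Summable (fun t => V (t + 1)) := by
    have := (summable_nat_add_iff 1).2 hvs
    simpa [hv_def] using this
  have eV : (∑' t : ℕ, ENNReal.ofReal (V (t + 1))).toReal = ∑' n, v n := by
    rw [← ENNReal.ofReal_tsum_of_nonneg (fun n => hV _ (by omega)) hvsS,
      ENNReal.toReal_ofReal (tsum_nonneg fun n => hV _ (by omega)), hvs.tsum_eq_zero_add, hv0,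
      zero_add]
    simp [hv_def]
  have hu1 : ∑' n, u n < 1 := by
    rw [← eU]
    have := (ENNReal.toReal_lt_toReal hUsum.ne_top ENNReal.one_ne_top).2 hUsum
    simpa using this
  have hx : ∀ n, renX U V n = v n + ∑ s ∈ Finset.range n, u (n - s) * renX U V s := by
    intro n
    rw [renX_rec]
    congr 1
    refine Finset.sum_congr rfl fun s hs => ?_
    have : n - s ≠ 0 := by simp at hs; omega
    simp [hu_def, this]
  have hua : Tendsto (fun n : ℕ => u n * (n : ℝ) ^ ξU) atTop (𝓝 CU) := by
    refine hUasymp.congr' ?_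
    filter_upwards [huU] with n hn
    rw [hn]
  have hva : Tendsto (fun n : ℕ => v n * (n : ℝ) ^ ξU) atTop (𝓝 0) := by
    have h1 := hvbig.mul (isBigO_refl (fun n : ℕ => (n : ℝ) ^ ξU) atTop)
    refine h1.trans_tendsto ?_
    have h2 := (tendsto_rpow_neg_atTop (y := ξV - ξU) (by linarith)).comp
      (tendsto_natCast_atTop_atTop (R := ℝ))
    refine h2.congr' ?_
    filter_upwards [eventually_gt_atTop 0] with n hn
    have : (0 : ℝ) < n := by exact_mod_cast hn
    simp only [Function.comp]
    rw [← Real.rpow_add this]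
    congr 1
    ring
  have main := ren_main hu hv hu0 hx hus hvs hu1 hξU hua hva
  rw [eU, eV]
  have m1 := (main.comp (tendsto_add_atTop_nat 1)).div
    ((ren_ratio ξU 1).comp (tendsto_add_atTop_nat 1)) one_ne_zero
  have m2 := m1.const_mul (1 / 2)
  have e : (∑' n, v n) * CU / (2 * (1 - ∑' n, u n) ^ 2)
      = 1 / 2 * ((∑' n, v n) * CU / (1 - ∑' n, u n) ^ 2 / 1) := by
    have : 1 - ∑' n, u n ≠ 0 := by linarith
    field_simp
  rw [e]
  refine m2.congr' ?_
  filter_upwards [eventually_gt_atTop 0] with t ht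
  have h1 : (0 : ℝ) < t := by exact_mod_cast ht
  simp only [Function.comp, Pi.div_apply, Nat.add_sub_cancel]
  rw [renX_loss, Real.div_rpow (by positivity) (by positivity)]
  have h2 : (0 : ℝ) < (t : ℝ) ^ ξU := by positivity
  have h3 : (0 : ℝ) < ((t + 1 : ℕ) : ℝ) ^ ξU := by positivity
  field_simp
end

section
/- F_U(r) = (1+o(1))·r^{θ−1}/(c·Γ(θ)) as r → 0+. -/
open Filter Topology MeasureTheory

/-- `F_U(r) = (1/2π)·∫_{−∞}^{∞} e^{irs}/(c·e^{i·sign(s)·θπ/2}·|s|^θ + 1) ds`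
(the real value of the integral, which is real by conjugation symmetry). -/
noncomputable def FUfun (c θ : ℝ) (r : ℝ) : ℝ :=
  ((1 / (2 * Real.pi)) * ∫ s : ℝ,
    Complex.exp (Complex.I * r * s) /
      ((c : ℂ) * Complex.exp (Complex.I * Real.sign s * θ * Real.pi / 2) *
        ((|s| ^ θ : ℝ) : ℂ) + 1)).re


lemma lower_bound (c θ : ℝ) (hc : 0 < c) (hθ1 : 1 < θ) (hθ2 : θ < 2) :
    ∃ K : ℝ, 0 < K ∧ ∀ (z : ℂ) (ρ : ℝ), 0 ≤ z.re → 0 ≤ ρ →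
      K * (c * ‖z‖ ^ θ + ρ) ≤ ‖(c : ℂ) * z ^ (θ : ℂ) + (ρ : ℂ)‖ := by
  have hpi := Real.pi_pos
  set k := Real.cos (Real.pi / 2 * θ) with hk
  have hk1 : -1 < k := by
    have := Real.cos_lt_cos_of_nonneg_of_le_pi (x := Real.pi / 2 * θ) (y := Real.pi)
      (by positivity) le_rfl (by nlinarith)
    simpa using this
  have hk0 : k ≤ 0 := Real.cos_nonpos_of_pi_div_two_le_of_le (by nlinarith) (by nlinarith)
  refine ⟨Real.sqrt ((1 + k) / 2), Real.sqrt_pos.2 (by linarith), fun z ρ hz hρ => ?_⟩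
  have harg : |z.arg| ≤ Real.pi / 2 := Complex.abs_arg_le_pi_div_two_iff.2 hz
  have hcos : k ≤ Real.cos (z.arg * θ) := by
    rw [← Real.cos_abs (z.arg * θ), abs_mul, abs_of_pos (by linarith : 0 < θ)]
    apply Real.cos_le_cos_of_nonneg_of_le_pi (by positivity) (by nlinarith)
    exact mul_le_mul_of_nonneg_right harg (by linarith)
  set R := ‖z‖ ^ θ with hR
  have hR0 : 0 ≤ R := by positivity
  refine (sq_le_sq₀ (by positivity) (norm_nonneg _)).1 ?_
  rw [mul_pow, Real.sq_sqrt (by linarith), ← Complex.normSq_eq_norm_sq, Complex.normSq_apply]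
  simp only [Complex.add_re, Complex.add_im, Complex.mul_re, Complex.mul_im, Complex.ofReal_re,
    Complex.ofReal_im, Complex.cpow_ofReal_re, Complex.cpow_ofReal_im, ← hR]
  have hs := Real.sin_sq_add_cos_sq (z.arg * θ)
  set C := Real.cos (z.arg * θ)
  set S := Real.sin (z.arg * θ)
  have e : (c * (R * C) - 0 * (R * S) + ρ) * (c * (R * C) - 0 * (R * S) + ρ) +
    (c * (R * S) + 0 * (R * C) + 0) * (c * (R * S) + 0 * (R * C) + 0)
      = (c * R) ^ 2 + ρ ^ 2 + 2 * ((c * R) * ρ) * C := by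
    linear_combination (c * R) ^ 2 * hs
  rw [e]
  have h1 : 0 ≤ (c * R) * ρ := by positivity
  have h2 := mul_le_mul_of_nonneg_left hcos h1
  nlinarith [sq_nonneg (c * R - ρ), mul_nonneg (neg_nonneg.2 hk0) (sq_nonneg (c * R - ρ))]

lemma norm_line (θ u : ℝ) : ‖(1 : ℂ) + u * Complex.I‖ ^ θ = (1 + ‖u‖ ^ 2) ^ (θ / 2) := by
  have h : ‖(1 : ℂ) + u * Complex.I‖ = Real.sqrt (1 + u ^ 2) := by
    have := Complex.norm_add_mul_I 1 u
    simpa using this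
  rw [h, Real.sqrt_eq_rpow, ← Real.rpow_mul (by positivity)]
  simp only [Real.norm_eq_abs, sq_abs]
  congr 1; ring

lemma gamma_complex (θ : ℝ) (hθ1 : 1 < θ) (p : ℂ) (hp : 0 < p.re) :
    ∫ t : ℝ in Set.Ioi 0, ((t ^ (θ - 1) : ℝ) : ℂ) * Complex.exp (-(p * t))
      = Complex.Gamma θ * p ^ (-(θ : ℂ)) := by
  set U : Set ℂ := {z | 0 < z.re} with hU
  have hUo : IsOpen U := isOpen_lt continuous_const Complex.continuous_re
  have hmeas : ∀ (a : ℝ), 0 ≤ a → ∀ q : ℂ, AEStronglyMeasurable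
      (fun t : ℝ => ((t ^ a : ℝ) : ℂ) * Complex.exp (-(q * t)))
      (volume.restrict (Set.Ioi 0)) := by
    intro a ha q
    apply Continuous.aestronglyMeasurable
    have := Real.continuous_rpow_const ha
    fun_prop
  have hnorm : ∀ (a : ℝ) (q : ℂ) (t : ℝ), 0 < t →
      ‖((t ^ a : ℝ) : ℂ) * Complex.exp (-(q * t))‖ = t ^ a * Real.exp (-q.re * t) := by
    intro a q t ht
    rw [norm_mul, Complex.norm_exp, Complex.norm_real, Real.norm_of_nonneg (by positivity)]
    simp
  have hint : ∀ (a : ℝ), 0 ≤ a → ∀ b : ℝ, 0 < b → IntegrableOn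
      (fun t : ℝ => t ^ a * Real.exp (-b * t)) (Set.Ioi 0) := by
    intro a ha b hb
    have := integrableOn_rpow_mul_exp_neg_mul_rpow (s := a) (p := 1) (b := b) (by linarith) one_pos hb
    simpa using this
  have hd : DifferentiableOn ℂ (fun p : ℂ => ∫ t : ℝ in Set.Ioi 0,
      ((t ^ (θ - 1) : ℝ) : ℂ) * Complex.exp (-(p * t))) U := by
    intro q hq
    have hq' : 0 < q.re := hq
    have key := hasDerivAt_integral_of_dominated_loc_of_deriv_le
      (μ := volume.restrict (Set.Ioi (0:ℝ)))
      (F := fun (p : ℂ) (t : ℝ) => ((t ^ (θ - 1) : ℝ) : ℂ) * Complex.exp (-(p * t)))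
      (F' := fun (p : ℂ) (t : ℝ) => -(((t ^ θ : ℝ) : ℂ) * Complex.exp (-(p * t))))
      (x₀ := q) (s := Metric.ball q (q.re / 2))
      (bound := fun t => t ^ θ * Real.exp (-(q.re / 2) * t))
      (Metric.ball_mem_nhds q (by positivity))
      (Eventually.of_forall fun x => hmeas _ (by linarith) x)
      ?_ (hmeas _ (by linarith) q).neg ?_ (hint θ (by linarith) _ (by positivity)) ?_
    · exact key.2.differentiableAt.differentiableWithinAt
    · refine (hint (θ - 1) (by linarith) q.re hq').mono' (hmeas _ (by linarith) q) ?_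
      filter_upwards [ae_restrict_mem measurableSet_Ioi] with t ht
      exact (hnorm _ _ _ ht).le
    · filter_upwards [ae_restrict_mem measurableSet_Ioi] with t ht x hx
      have ht' : 0 < t := ht
      rw [norm_neg, hnorm _ _ _ ht]
      have h1 : |(x - q).re| < q.re / 2 :=
        (Complex.abs_re_le_norm _).trans_lt (by simpa [dist_eq_norm] using hx)
      rw [abs_lt, Complex.sub_re] at h1
      gcongr
      linarith [h1.1]
    · filter_upwards [ae_restrict_mem measurableSet_Ioi] with t ht x hx
      have ht' : 0 < t := ht
      have h1 : HasDerivAt (fun p : ℂ => -(p * (t:ℂ))) (-(1 * (t:ℂ))) x :=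
        ((hasDerivAt_id x).mul_const (t:ℂ)).neg
      have h2 := (h1.cexp).const_mul (((t ^ (θ - 1) : ℝ) : ℂ))
      convert! h2 using 1
      have : t ^ θ = t ^ (θ - 1) * t := by
        rw [← Real.rpow_add_one ht'.ne']; congr 1; ring
      rw [this]; push_cast; ring
  have hd2 : DifferentiableOn ℂ (fun p : ℂ => Complex.Gamma θ * p ^ (-(θ : ℂ))) U := by
    intro q hq
    have : DifferentiableAt ℂ (fun p : ℂ => p ^ (-(θ : ℂ))) q :=
      differentiableAt_id.cpow_const (Or.inl hq)
    exact (this.const_mul _).differentiableWithinAt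
  have hconv : IsPreconnected U := (convex_halfSpace_re_gt 0).isPreconnected
  refine (hd.analyticOnNhd hUo).eqOn_of_preconnected_of_frequently_eq (hd2.analyticOnNhd hUo)
    hconv (z₀ := 1) (by simp [hU]) ?_ hp
  have hpos : ∀ x : ℝ, 0 < x → (∫ t : ℝ in Set.Ioi 0,
      ((t ^ (θ - 1) : ℝ) : ℂ) * Complex.exp (-((x:ℂ) * t))) = Complex.Gamma θ * (x:ℂ) ^ (-(θ : ℂ)) := by
    intro x hx
    have := Complex.integral_cpow_mul_exp_neg_mul_Ioi (a := θ) (r := x) (by simp; linarith) hx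
    rw [mul_comm, Complex.cpow_neg, ← Complex.inv_cpow, ← one_div, ← this]
    · refine setIntegral_congr_fun measurableSet_Ioi fun t ht => ?_
      have ht' : 0 < t := ht
      rw [Complex.ofReal_cpow ht'.le]; push_cast; rfl
    · rw [Complex.arg_ofReal_of_nonneg hx.le]; exact Real.pi_pos.ne
  have ht : Tendsto (fun x : ℝ => (x : ℂ)) (𝓝[≠] 1) (𝓝[≠] 1) := by
    refine tendsto_nhdsWithin_iff.2 ⟨?_, ?_⟩
    · exact (Complex.continuous_ofReal.tendsto' 1 1 (by simp)).mono_left nhdsWithin_le_nhds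
    · filter_upwards [self_mem_nhdsWithin] with x hx
      simpa using hx
  refine ht.frequently (Eventually.frequently ?_)
  filter_upwards [nhdsWithin_le_nhds (lt_mem_nhds (zero_lt_one : (0:ℝ) < 1))] with x hx
  exact hpos x hx

open FourierTransform in
lemma hankel (θ : ℝ) (hθ1 : 1 < θ) :
    ∫ u : ℝ, Complex.exp (1 + u * Complex.I) / (1 + u * Complex.I) ^ (θ : ℂ)
      = 2 * Real.pi / Complex.Gamma θ := by
  have hpi := Real.pi_pos
  set f : ℝ → ℂ := (Set.Ioi 0).indicator
    (fun t : ℝ => ((t ^ (θ - 1) : ℝ) : ℂ) * Complex.exp (-t)) with hf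
  have hre : ∀ u : ℝ, ((1 : ℂ) + u * Complex.I).re = 1 := by intro u; simp
  have hF : 𝓕 f = fun w : ℝ => Complex.Gamma θ * (1 + ((2 * Real.pi * w : ℝ) : ℂ) * Complex.I) ^ (-(θ : ℂ)) := by
    ext w
    rw [Real.fourier_real_eq_integral_exp_smul,
      ← gamma_complex θ hθ1 _ (by rw [hre]; norm_num), ← integral_indicator measurableSet_Ioi]
    congr 1; ext v
    by_cases hv : v ∈ Set.Ioi (0:ℝ)
    · simp only [hf, Set.indicator_of_mem hv, smul_eq_mul]
      rw [mul_left_comm, ← Complex.exp_add]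
      congr 2; push_cast; ring
    · simp [hf, Set.indicator_of_notMem hv]
  have hfi : Integrable f := by
    rw [hf, integrable_indicator_iff measurableSet_Ioi]
    have := Real.GammaIntegral_convergent (s := θ) (by linarith)
    refine (Integrable.ofReal (𝕜 := ℂ) this).congr (Eventually.of_forall fun t => ?_)
    simp [mul_comm]
  have hli : Integrable (fun u : ℝ => ((1:ℂ) + u * Complex.I) ^ (-(θ : ℂ))) := by
    have := integrable_rpow_neg_one_add_norm_sq (E := ℝ) (μ := volume) (r := θ) (by simpa using hθ1)
    refine this.mono' ?_ (Eventually.of_forall fun u => ?_)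
    · apply Continuous.aestronglyMeasurable
      refine continuous_iff_continuousAt.2 fun u => ContinuousAt.cpow (by fun_prop) continuousAt_const (Or.inl ?_)
      rw [hre]; norm_num
    · rw [← norm_line, ← Complex.ofReal_neg, Complex.norm_cpow_real]
  have hFi : Integrable (𝓕 f) := by
    rw [hF]
    exact (hli.comp_mul_left' (by positivity : 2 * Real.pi ≠ 0)).const_mul _
  have hcont : ContinuousAt f 1 := by
    have : ContinuousAt (fun t : ℝ => ((t ^ (θ - 1) : ℝ) : ℂ) * Complex.exp (-t)) 1 := by
      have := Real.continuous_rpow_const (q := θ - 1) (by linarith)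
      exact Continuous.continuousAt (by fun_prop)
    refine this.congr ?_
    filter_upwards [lt_mem_nhds (zero_lt_one : (0:ℝ) < 1)] with t ht
    rw [hf, Set.indicator_of_mem (by exact ht)]
  have inv := hfi.fourierInv_fourier_eq hFi hcont
  rw [hF, Real.fourierInv_eq'] at inv
  have hG : Complex.Gamma θ ≠ 0 := Complex.Gamma_ne_zero_of_re_pos (by simp; linarith)
  have hsub := Measure.integral_comp_mul_left (fun u : ℝ => Complex.exp (1 + u * Complex.I) / (1 + u * Complex.I) ^ (θ : ℂ)) (2 * Real.pi)
  have e1 : f 1 = Complex.exp (-1) := by simp [hf]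
  rw [e1] at inv
  have e2 : (∫ x : ℝ, Complex.exp (1 + ((2 * Real.pi * x : ℝ) : ℂ) * Complex.I) / (1 + ((2 * Real.pi * x : ℝ) : ℂ) * Complex.I) ^ (θ : ℂ))
     = 1 / Complex.Gamma θ := by
    have : (1:ℂ) / Complex.Gamma θ = (Complex.exp 1 / Complex.Gamma θ) * Complex.exp (-1) := by
      rw [Complex.exp_neg]; field_simp [Complex.exp_ne_zero]
    rw [this, ← inv, ← integral_const_mul]
    congr 1; ext x
    rw [Complex.cpow_neg, Complex.exp_add, smul_eq_mul]
    simp only [RCLike.inner_apply, conj_trivial, one_mul]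
    field_simp
  rw [e2] at hsub
  rw [abs_of_pos (by positivity)] at hsub
  have h2 : (2 * Real.pi : ℂ) ≠ 0 := by
    exact_mod_cast (by positivity : 2 * Real.pi ≠ 0)
  rw [Complex.real_smul] at hsub
  push_cast at hsub
  rw [inv_mul_eq_div, eq_div_iff h2] at hsub
  rw [← hsub]; ring

lemma shift (c θ ρ : ℝ) (hc : 0 < c) (hθ1 : 1 < θ) (hθ2 : θ < 2) (hρ : 0 < ρ) :
    ∫ u : ℝ, Complex.exp (u * Complex.I) / (c * (u * Complex.I) ^ (θ : ℂ) + ρ)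
      = ∫ u : ℝ, Complex.exp (1 + u * Complex.I) / (c * (1 + u * Complex.I) ^ (θ : ℂ) + ρ) := by
  obtain ⟨K, hK, hlb⟩ := lower_bound c θ hc hθ1 hθ2
  set f : ℂ → ℂ := fun z => Complex.exp z / (c * z ^ (θ : ℂ) + ρ) with hf
  have hDpos : ∀ z : ℂ, 0 ≤ z.re → 0 < K * (c * ‖z‖ ^ θ + ρ) := fun z _ => by positivity
  have hne : ∀ z : ℂ, 0 ≤ z.re → (c : ℂ) * z ^ (θ : ℂ) + ρ ≠ 0 := fun z hz => by
    rw [← norm_pos_iff]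
    exact (hDpos z hz).trans_le (hlb z ρ hz hρ.le)
  have hbound : ∀ z : ℂ, 0 ≤ z.re → ‖f z‖ ≤ Real.exp z.re / (K * (c * ‖z‖ ^ θ + ρ)) := by
    intro z hz
    rw [hf, norm_div, Complex.norm_exp]
    exact div_le_div_of_nonneg_left (Real.exp_pos _).le (hDpos z hz) (hlb z ρ hz hρ.le)
  have hcont : ∀ z : ℂ, 0 ≤ z.re → ContinuousAt f z := by
    intro z hz
    have h1 : ContinuousAt (fun z : ℂ => z ^ (θ : ℂ)) z :=
      Complex.continuousAt_cpow_const_of_re_pos (Or.inl hz) (by simp; linarith)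
    exact (Complex.continuous_exp.continuousAt).div
      ((continuousAt_const.mul h1).add continuousAt_const) (hne z hz)
  have hdiff : ∀ z : ℂ, 0 < z.re → DifferentiableAt ℂ f z := by
    intro z hz
    have h1 : DifferentiableAt ℂ (fun z : ℂ => z ^ (θ : ℂ)) z :=
      differentiableAt_id.cpow_const (Or.inl hz)
    exact (Complex.differentiableAt_exp).div ((h1.const_mul _).add_const _) (hne z hz.le)
  -- integrability on vertical lines
  have hint : ∀ a : ℝ, 0 ≤ a → Integrable (fun u : ℝ => f (a + u * Complex.I)) := by
    intro a ha
    have hre : ∀ u : ℝ, ((a : ℂ) + u * Complex.I).re = a := by intro u; simp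
    have h0 := integrable_rpow_neg_one_add_norm_sq (E := ℝ) (μ := volume) (r := θ)
      (by simpa using hθ1)
    refine (h0.const_mul (Real.exp a / (K * min c ρ))).mono' ?_ (Eventually.of_forall fun u => ?_)
    · apply Continuous.aestronglyMeasurable
      refine continuous_iff_continuousAt.2 fun u => ?_
      exact ContinuousAt.comp (g := f) (hcont _ (by rw [hre]; exact ha)) (by fun_prop)
    · refine (hbound _ (by rw [hre]; exact ha)).trans ?_
      rw [hre, neg_div, Real.rpow_neg (by positivity), ← div_eq_mul_inv, div_div, mul_assoc]
      have hm : 0 < min c ρ := lt_min hc hρ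
      apply div_le_div_of_nonneg_left (Real.exp_pos _).le (by positivity)
      apply mul_le_mul_of_nonneg_left _ hK.le
      have h2 : (1 + ‖u‖ ^ 2) ^ (θ / 2) ≤ 1 + ‖u‖ ^ θ := by
        have := Real.rpow_add_le_add_rpow (a := 1) (b := ‖u‖ ^ 2) (p := θ / 2) zero_le_one
          (by positivity) (by linarith) (by linarith)
        have hh : (‖u‖ ^ 2) ^ (θ / 2) = ‖u‖ ^ θ := by
          rw [← Real.rpow_natCast, ← Real.rpow_mul (norm_nonneg u)]
          congr 1; push_cast; ring
        rwa [Real.one_rpow, hh] at this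
      have h3 : ‖u‖ ^ θ ≤ ‖(a : ℂ) + u * Complex.I‖ ^ θ := by
        apply Real.rpow_le_rpow (by positivity) _ (by linarith)
        have := Complex.abs_im_le_norm ((a : ℂ) + u * Complex.I)
        simpa using this
      have h4 : 0 ≤ ‖u‖ ^ θ := by positivity
      calc min c ρ * (1 + ‖u‖ ^ 2) ^ (θ / 2) ≤ min c ρ * (1 + ‖u‖ ^ θ) := by gcongr
        _ = min c ρ * ‖u‖ ^ θ + min c ρ := by ring
        _ ≤ c * ‖(a : ℂ) + u * Complex.I‖ ^ θ + ρ := by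
          gcongr
          · exact min_le_left _ _
          · exact min_le_right _ _
  -- horizontal sides vanish
  have hhor : ∀ ε : ℝ, |ε| = 1 →
      Tendsto (fun T : ℝ => ∫ x : ℝ in (0:ℝ)..1, f (x + ((ε * T : ℝ) : ℂ) * Complex.I)) atTop (𝓝 0) := by
    intro ε hε
    have hlim : Tendsto (fun T : ℝ => Real.exp 1 / (K * c) * T ^ (-θ)) atTop (𝓝 0) := by
      simpa using (tendsto_rpow_neg_atTop (by linarith : 0 < θ)).const_mul (Real.exp 1 / (K * c))
    refine squeeze_zero_norm' ?_ hlim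
    filter_upwards [eventually_gt_atTop 0] with T hT
    have := intervalIntegral.norm_integral_le_of_norm_le_const (a := (0:ℝ)) (b := 1)
      (C := Real.exp 1 / (K * c) * T ^ (-θ))
      (f := fun x : ℝ => f (x + ((ε * T : ℝ) : ℂ) * Complex.I)) ?_
    · simpa using this
    intro x hx
    rw [Set.uIoc_of_le zero_le_one] at hx
    have hre : ((x : ℂ) + ((ε * T : ℝ) : ℂ) * Complex.I).re = x := by simp
    have him : |((x : ℂ) + ((ε * T : ℝ) : ℂ) * Complex.I).im| = T := by
      simp [abs_mul, hε, abs_of_pos hT]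
    have hn : T ≤ ‖(x : ℂ) + ((ε * T : ℝ) : ℂ) * Complex.I‖ :=
      him.symm.le.trans (Complex.abs_im_le_norm _)
    refine (hbound _ (by rw [hre]; exact hx.1.le)).trans ?_
    rw [hre, Real.rpow_neg hT.le, ← div_eq_mul_inv, div_div, mul_assoc]
    have hTp : 0 < T ^ θ := by positivity
    have h5 : T ^ θ ≤ ‖(x : ℂ) + ((ε * T : ℝ) : ℂ) * Complex.I‖ ^ θ :=
      Real.rpow_le_rpow hT.le hn (by linarith)
    have h6 : c * T ^ θ ≤ c * ‖(x : ℂ) + ((ε * T : ℝ) : ℂ) * Complex.I‖ ^ θ + ρ := by nlinarith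
    exact div_le_div₀ (Real.exp_pos _).le (Real.exp_le_exp.2 hx.2) (by positivity)
      (mul_le_mul_of_nonneg_left h6 hK.le)
  have hv0 := intervalIntegral_tendsto_integral (hint 0 le_rfl) tendsto_neg_atTop_atBot tendsto_id
  have hv1 := intervalIntegral_tendsto_integral (hint 1 zero_le_one) tendsto_neg_atTop_atBot
    tendsto_id
  have hb := hhor (-1) (by simp)
  have ht := hhor 1 (by simp)
  have hall := (((hb.sub ht).add (hv1.const_smul Complex.I)).sub (hv0.const_smul Complex.I))
  have hzero : ∀ᶠ T : ℝ in atTop, (((∫ x : ℝ in (0:ℝ)..1, f (x + (((-1) * T : ℝ) : ℂ) * Complex.I)) -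
      ∫ x : ℝ in (0:ℝ)..1, f (x + ((1 * T : ℝ) : ℂ) * Complex.I)) +
      Complex.I • ∫ y : ℝ in (-T)..(id T), f (((1:ℝ):ℂ) + y * Complex.I)) -
      Complex.I • (∫ y : ℝ in (-T)..(id T), f (((0:ℝ):ℂ) + y * Complex.I)) = 0 := by
    filter_upwards [eventually_gt_atTop 0] with T hT
    have := Complex.integral_boundary_rect_eq_zero_of_continuousOn_of_differentiableOn f
      ⟨0, -T⟩ ⟨1, T⟩ ?_ ?_
    · simpa using this
    · intro z hz
      have : z.re ∈ Set.uIcc (0:ℝ) 1 := hz.1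
      rw [Set.uIcc_of_le zero_le_one] at this
      exact (hcont z this.1).continuousWithinAt
    · intro z hz
      have : z.re ∈ Set.Ioo (min (0:ℝ) 1) (max 0 1) := hz.1
      simp at this
      exact (hdiff z this.1).differentiableWithinAt
  have hlim0 := tendsto_nhds_unique (hall.congr' hzero) tendsto_const_nhds
  have h7 : (∫ u : ℝ, f (((1:ℝ):ℂ) + u * Complex.I)) = ∫ u : ℝ, f (((0:ℝ):ℂ) + u * Complex.I) := by
    have hI := Complex.I_ne_zero
    simp only [sub_zero, zero_add, smul_eq_mul, ← mul_sub] at hlim0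
    exact sub_eq_zero.1 ((mul_eq_zero.1 hlim0).resolve_left hI)
  simpa [hf] using h7.symm

lemma cpow_I (θ u : ℝ) (hθ1 : 1 < θ) : ((u : ℂ) * Complex.I) ^ (θ : ℂ) =
    Complex.exp (Complex.I * Real.sign u * θ * Real.pi / 2) * ((|u| ^ θ : ℝ) : ℂ) := by
  rw [Complex.cpow_ofReal]
  have hn : ‖(u : ℂ) * Complex.I‖ = |u| := by simp
  rcases lt_trichotomy u 0 with h | h | h
  · have ha : ((u : ℂ) * Complex.I).arg = -(Real.pi / 2) := by
      rw [Complex.arg_eq_neg_pi_div_two_iff]; simpa using h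
    rw [hn, ha, Real.sign_of_neg h, mul_comm, Complex.ofReal_cos, Complex.ofReal_sin,
      ← Complex.exp_mul_I]
    congr 2; push_cast; ring
  · subst h
    simp [Real.zero_rpow (by linarith : θ ≠ 0)]
  · have ha : ((u : ℂ) * Complex.I).arg = Real.pi / 2 := by
      rw [Complex.arg_eq_pi_div_two_iff]; simpa using h
    rw [hn, ha, Real.sign_of_pos h, mul_comm, Complex.ofReal_cos, Complex.ofReal_sin,
      ← Complex.exp_mul_I]
    congr 2; push_cast; ring

lemma FU_eq (c θ r : ℝ) (hc : 0 < c) (hθ1 : 1 < θ) (hθ2 : θ < 2) (hr : 0 < r) :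
    FUfun c θ r = r ^ (θ - 1) * ((1 / (2 * Real.pi)) *
      ∫ u : ℝ, Complex.exp (1 + u * Complex.I) /
        (c * (1 + u * Complex.I) ^ (θ : ℂ) + ((r ^ θ : ℝ) : ℂ))).re := by
  rw [← shift c θ (r ^ θ) hc hθ1 hθ2 (by positivity)]
  have hsub := Measure.integral_comp_mul_left (fun u : ℝ => Complex.exp (u * Complex.I) /
    (c * (u * Complex.I) ^ (θ : ℂ) + ((r ^ θ : ℝ) : ℂ))) r
  have hrt : 0 < r ^ θ := by positivity
  have e : (∫ s : ℝ, Complex.exp (Complex.I * r * s) /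
      ((c : ℂ) * Complex.exp (Complex.I * Real.sign s * θ * Real.pi / 2) *
        ((|s| ^ θ : ℝ) : ℂ) + 1)) = ((r ^ θ : ℝ) : ℂ) * ∫ s : ℝ, Complex.exp (((r * s : ℝ) : ℂ) * Complex.I) /
    (c * (((r * s : ℝ) : ℂ) * Complex.I) ^ (θ : ℂ) + ((r ^ θ : ℝ) : ℂ)) := by
    rw [← integral_const_mul]
    congr 1; ext s
    have hsg : Real.sign (r * s) = Real.sign s := by
      rcases lt_trichotomy s 0 with h | h | h
      · rw [Real.sign_of_neg h, Real.sign_of_neg (mul_neg_of_pos_of_neg hr h)]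
      · simp [h]
      · rw [Real.sign_of_pos h, Real.sign_of_pos (mul_pos hr h)]
    rw [cpow_I θ (r * s) hθ1, hsg, abs_mul, abs_of_pos hr, Real.mul_rpow hr.le (abs_nonneg s)]
    have hne : ((r ^ θ : ℝ) : ℂ) ≠ 0 := by exact_mod_cast hrt.ne'
    have e1 : Complex.I * r * s = ((r * s : ℝ) : ℂ) * Complex.I := by push_cast; ring
    rw [e1, ← mul_div_assoc, Complex.ofReal_mul (r ^ θ)]
    rw [← mul_div_mul_left _ _ hne]
    congr 1; ring
  unfold FUfun
  rw [e, hsub, abs_of_pos (by positivity), Real.rpow_sub_one hr.ne', Complex.real_smul,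
    ← Complex.re_ofReal_mul]
  congr 1; push_cast; ring

/-- `F_U(r) = (1+o(1))·r^{θ−1}/(c·Γ(θ))` as `r → 0+`. -/
theorem stmt11 (c θ : ℝ) (hc : 0 < c) (hθ1 : 1 < θ) (hθ2 : θ < 2) :
    Tendsto (fun r : ℝ => FUfun c θ r / (r ^ (θ - 1) / (c * Real.Gamma θ)))
      (𝓝[>] 0) (𝓝 1) := by
  obtain ⟨K, hK, hlb⟩ := lower_bound c θ hc hθ1 hθ2
  have hG : 0 < Real.Gamma θ := Real.Gamma_pos_of_pos (by linarith)
  have hpi := Real.pi_pos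
  have hre : ∀ u : ℝ, ((1 : ℂ) + u * Complex.I).re = 1 := by intro u; simp
  have hnpos : ∀ u : ℝ, 0 < ‖(1 : ℂ) + u * Complex.I‖ := fun u => by
    rw [norm_pos_iff]; intro h; have := hre u; rw [h] at this; simp at this
  have hcp : Continuous (fun u : ℝ => ((1 : ℂ) + u * Complex.I) ^ (θ : ℂ)) := by
    refine continuous_iff_continuousAt.2 fun u =>
      ContinuousAt.cpow (by fun_prop) continuousAt_const (Or.inl ?_)
    rw [hre]; norm_num
  have hne : ∀ (u ρ : ℝ), 0 ≤ ρ → (c : ℂ) * (1 + u * Complex.I) ^ (θ : ℂ) + (ρ : ℂ) ≠ 0 := by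
    intro u ρ hρ
    rw [← norm_pos_iff]
    refine lt_of_lt_of_le ?_ (hlb _ ρ (by rw [hre]; norm_num) hρ)
    have := hnpos u
    positivity
  have hrpow : Tendsto (fun r : ℝ => r ^ θ) (𝓝[>] 0) (𝓝 0) := by
    have := (Real.continuous_rpow_const (q := θ) (by linarith)).tendsto' 0 0
      (Real.zero_rpow (by linarith))
    exact this.mono_left nhdsWithin_le_nhds
  have hdct : Tendsto (fun r : ℝ => ∫ u : ℝ, Complex.exp (1 + u * Complex.I) /
        (c * (1 + u * Complex.I) ^ (θ : ℂ) + ((r ^ θ : ℝ) : ℂ))) (𝓝[>] 0)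
      (𝓝 (∫ u : ℝ, Complex.exp (1 + u * Complex.I) /
        (c * (1 + u * Complex.I) ^ (θ : ℂ) + ((0 : ℝ) : ℂ)))) := by
    have h0 := integrable_rpow_neg_one_add_norm_sq (E := ℝ) (μ := volume) (r := θ)
      (by simpa using hθ1)
    refine tendsto_integral_filter_of_dominated_convergence _ ?_ ?_
      (h0.const_mul (Real.exp 1 / (K * c))) ?_
    · filter_upwards [self_mem_nhdsWithin] with r hr
      have hr' : 0 < r := hr
      apply Continuous.aestronglyMeasurable
      exact Continuous.div (by fun_prop) (by fun_prop) (fun u => hne u _ (by positivity))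
    · filter_upwards [self_mem_nhdsWithin] with r hr
      have hr' : 0 < r := hr
      refine Eventually.of_forall fun u => ?_
      have hl := hlb (1 + u * Complex.I) (r ^ θ) (by rw [hre]; norm_num) (by positivity)
      have hp := hnpos u
      rw [norm_div, Complex.norm_exp, hre, neg_div, Real.rpow_neg (by positivity), ← norm_line,
        ← div_eq_mul_inv, div_div]
      apply div_le_div_of_nonneg_left (Real.exp_pos _).le (by positivity)
      have : 0 < K * r ^ θ := by positivity
      linarith
    · refine Eventually.of_forall fun u => ?_
      refine tendsto_const_nhds.div (tendsto_const_nhds.add ?_) (hne u 0 le_rfl)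
      exact (Complex.continuous_ofReal.tendsto 0).comp hrpow
  have hval : (∫ u : ℝ, Complex.exp (1 + u * Complex.I) /
        (c * (1 + u * Complex.I) ^ (θ : ℂ) + ((0 : ℝ) : ℂ))) =
      ((2 * Real.pi / (c * Real.Gamma θ) : ℝ) : ℂ) := by
    have hcc : (c : ℂ) ≠ 0 := by exact_mod_cast hc.ne'
    have : ∀ u : ℝ, Complex.exp (1 + u * Complex.I) /
        (c * (1 + u * Complex.I) ^ (θ : ℂ) + ((0 : ℝ) : ℂ)) =
        (c : ℂ)⁻¹ * (Complex.exp (1 + u * Complex.I) / (1 + u * Complex.I) ^ (θ : ℂ)) := by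
      intro u
      rw [Complex.ofReal_zero, add_zero, ← div_div, div_eq_inv_mul _ (c : ℂ), mul_div_assoc]
    simp_rw [this]
    rw [integral_const_mul, hankel θ hθ1, Complex.Gamma_ofReal]
    push_cast
    rw [div_eq_mul_inv, div_eq_mul_inv, mul_inv]
    ring
  rw [hval] at hdct
  have hfin := ((Complex.continuous_re.tendsto _).comp
    (hdct.const_mul (1 / (2 * (Real.pi : ℂ))))).mul_const (c * Real.Gamma θ)
  have hone : ((1 / (2 * (Real.pi : ℂ))) * ((2 * Real.pi / (c * Real.Gamma θ) : ℝ) : ℂ)).re *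
      (c * Real.Gamma θ) = 1 := by
    have : (1 / (2 * (Real.pi : ℂ))) * ((2 * Real.pi / (c * Real.Gamma θ) : ℝ) : ℂ) =
      ((1 / (2 * Real.pi) * (2 * Real.pi / (c * Real.Gamma θ)) : ℝ) : ℂ) := by push_cast; ring
    rw [this, Complex.ofReal_re]
    field_simp
  rw [hone] at hfin
  refine hfin.congr' ?_
  filter_upwards [self_mem_nhdsWithin] with r hr
  have hr' : 0 < r := hr
  have hrp : r ^ (θ - 1) ≠ 0 := (Real.rpow_pos_of_pos hr' _).ne'
  rw [FU_eq c θ r hc hθ1 hθ2 hr']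
  simp only [Function.comp]
  generalize (1 / (2 * (Real.pi : ℂ)) * ∫ u : ℝ, Complex.exp (1 + u * Complex.I) /
        (c * (1 + u * Complex.I) ^ (θ : ℂ) + ((r ^ θ : ℝ) : ℂ))).re = X
  field_simp
end
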